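/- arXiv:math/0310493 — 7 statements merged into one kernel-verified Lean document; each statement's English description precedes it below -/
import Mathlib

section
/- Let K be a field and d > 1 an integer. For every integer k with 1 ≤ k < d, the ideal J^k has linear quotients; that is, there is an ordering u₁,…,u_s of the minimal monomial generators of J^k such that for every index i with 1 ≤ i ≤ s, the colon ideal (u₁,…,u_{i−1}) : (u_i) is generated by a subset of the variables {x₁, x₂, z₁, z₂}. -/
open MvPolynomial

/-- exponent vectors of the generators of `J^k`, where `d = D+1` -/
def GG (D k : ℕ) : Set (Fin 4 →₀ ℕ) :=
  {v | ∃ p i b c m n : ℕ, p + i + b + c = k ∧ m + n = (D + 2) * c ∧ v 0 = p + i ∧ v 1 = b ∧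
    v 2 = (D + 1) * p + D * b + n ∧ v 3 = (D + 1) * i + b + m}

theorem GG_prop {D k : ℕ} {v : Fin 4 →₀ ℕ} (h : v ∈ GG D k) :
    v 0 + v 1 ≤ k ∧ v 0 + v 1 + v 2 + v 3 = k * (D + 2) ∧ v 1 ≤ v 3 ∧ D * v 1 ≤ v 2 := by
  obtain ⟨p, i, b, c, m, n, h1, h2, h3, h4, h5, h6⟩ := h
  rw [h3, h4, h5, h6]
  refine ⟨by omega, ?_, by nlinarith, by nlinarith⟩
  subst h1
  nlinarith

theorem GG_mk {D k : ℕ} {v : Fin 4 →₀ ℕ} (h1 : v 0 + v 1 < k)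
    (h2 : v 0 + v 1 + v 2 + v 3 = k * (D + 2)) (h3 : v 1 ≤ v 3) (h4 : D * v 1 ≤ v 2) :
    v ∈ GG D k := by
  obtain ⟨c, hc⟩ : ∃ c, k = v 0 + v 1 + (c + 1) := ⟨k - (v 0 + v 1) - 1, by omega⟩
  obtain ⟨E, hE⟩ := Nat.exists_eq_add_of_le h3
  obtain ⟨F, hF⟩ := Nat.exists_eq_add_of_le h4
  have hEF : E + F = (D + 1) * v 0 + (D + 2) * (c + 1) := by
    rw [hE, hF, hc] at h2
    nlinarith
  by_cases hq : v 0 ≤ E / (D + 1)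
  · have hm : (D + 1) * v 0 ≤ E := by
      have := Nat.mul_div_le E (D + 1)
      nlinarith
    obtain ⟨m, hm⟩ := Nat.exists_eq_add_of_le hm
    refine ⟨0, v 0, v 1, c + 1, m, F, by omega, ?_, by omega, rfl, by rw [hF]; ring, ?_⟩
    · omega
    · rw [hE, hm]; ring
  · push Not at hq
    obtain ⟨p, hp⟩ := Nat.exists_eq_add_of_lt hq
    have hdiv := Nat.div_add_mod E (D + 1)
    have hlt := Nat.mod_lt E (Nat.succ_pos D)
    set i := E / (D + 1)
    set m := E % (D + 1)
    have hm : m ≤ (D + 2) * (c + 1) := by nlinarith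
    obtain ⟨n, hn⟩ := Nat.exists_eq_add_of_le hm
    refine ⟨p + 1, i, v 1, c + 1, m, n, by omega, hn.symm, by omega, rfl, ?_, ?_⟩
    · rw [hF]
      have : F = (D + 1) * (p + 1) + n := by
        rw [hp] at hEF
        nlinarith
      rw [this]; ring
    · rw [hE, ← hdiv]; ring

theorem GG_fin (D k : ℕ) : (GG D k).Finite := by
  refine (Set.finite_Iic (Finsupp.equivFunOnFinite.symm (fun _ : Fin 4 => k * (D + 2)))).subset ?_
  intro v hv
  obtain ⟨-, h, -, -⟩ := GG_prop hv
  intro j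
  fin_cases j <;> (try simp) <;> omega

/-- the order used -/
def rk (v : Fin 4 →₀ ℕ) : ℕ ×ₗ ℕ ×ₗ ℕ := toLex (v 0 + v 1, toLex (v 1, v 3))

theorem rk_lt (v w : Fin 4 →₀ ℕ) : rk v < rk w ↔ v 0 + v 1 < w 0 + w 1 ∨
    (v 0 + v 1 = w 0 + w 1 ∧ (v 1 < w 1 ∨ v 1 = w 1 ∧ v 3 < w 3)) := by
  simp [rk, Prod.Lex.toLex_lt_toLex]

theorem rk_inj (D k : ℕ) : Set.InjOn rk (GG D k) := by
  intro v hv w hw h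
  have h1 := GG_prop hv
  have h2 := GG_prop hw
  simp only [rk, toLex_inj, Prod.mk.injEq] at h
  ext j
  fin_cases j <;> (try simp) <;> omega

/-- vector from entries -/
noncomputable def V (a b c e : ℕ) : Fin 4 →₀ ℕ := Finsupp.equivFunOnFinite.symm ![a, b, c, e]

theorem crit {D k : ℕ} (hk : k ≤ D) {u v : Fin 4 →₀ ℕ} (hu : u ∈ GG D k) (hv : v ∈ GG D k)
    (h : rk v < rk u) : ∃ y, u y < v y ∧ ∃ w ∈ GG D k, rk w < rk u ∧
      w ≤ u + Finsupp.single y 1 := by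
  obtain ⟨u1, u2, u3, u4⟩ := GG_prop hu
  obtain ⟨v1, v2, v3, v4⟩ := GG_prop hv
  rw [rk_lt] at h
  -- general construction
  have mk : ∀ (a b c e : ℕ) (y : Fin 4), a + b < k → a + b + c + e = k * (D + 2) → b ≤ e →
      D * b ≤ c → (a + b < u 0 + u 1 ∨ (a + b = u 0 + u 1 ∧ (b < u 1 ∨ b = u 1 ∧ e < u 3))) →
      a ≤ u 0 + Finsupp.single y 1 0 → b ≤ u 1 + Finsupp.single y 1 1 →
      c ≤ u 2 + Finsupp.single y 1 2 → e ≤ u 3 + Finsupp.single y 1 3 →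
      ∃ w ∈ GG D k, rk w < rk u ∧ w ≤ u + Finsupp.single y 1 := by
    intro a b c e y h1 h2 h3 h4 h5 l0 l1 l2 l3
    refine ⟨V a b c e, GG_mk h1 h2 h3 h4, ?_, ?_⟩
    · rw [rk_lt]; exact h5
    · intro j
      fin_cases j
      · exact l0
      · exact l1
      · exact l2
      · exact l3
  have step : ∀ b, D * (b - 1) ≤ D * b := fun b => Nat.mul_le_mul_left _ (by omega)
  have step1 := step (u 1)
  by_cases ht : u 0 + u 1 = 0
  · -- only z's
    have hv3 : v 3 < u 3 := by omega
    refine ⟨2, by omega, mk 0 0 (u 2 + 1) (u 3 - 1) 2 ?_ ?_ ?_ ?_ ?_ ?_ ?_ ?_ ?_⟩ <;>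
      simp <;> first | omega | skip
    by_contra hk0
    have : k = 0 := by omega
    subst this
    omega
  by_cases h2 : u 2 < v 2
  · refine ⟨2, h2, ?_⟩
    by_cases ha : u 0 = 0
    · refine mk 0 (u 1 - 1) (u 2 + 1) (u 3) 2 ?_ ?_ ?_ ?_ ?_ ?_ ?_ ?_ ?_ <;> (try simp) <;> omega
    · refine mk (u 0 - 1) (u 1) (u 2 + 1) (u 3) 2 ?_ ?_ ?_ ?_ ?_ ?_ ?_ ?_ ?_ <;> (try simp) <;> omega
  by_cases h3 : u 3 < v 3
  · refine ⟨3, h3, ?_⟩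
    by_cases ha : u 0 = 0
    · refine mk 0 (u 1 - 1) (u 2) (u 3 + 1) 3 ?_ ?_ ?_ ?_ ?_ ?_ ?_ ?_ ?_ <;> (try simp) <;> omega
    · refine mk (u 0 - 1) (u 1) (u 2) (u 3 + 1) 3 ?_ ?_ ?_ ?_ ?_ ?_ ?_ ?_ ?_ <;> (try simp) <;> omega
  have e3 : u 3 = v 3 := by omega
  have e2 : u 2 = v 2 := by omega
  have hb : v 1 < u 1 := by omega
  have hlt : u 0 + u 1 < k := by
    by_contra hcon
    obtain ⟨p, i, b, c, m, n, g1, g2, g3, g4, g5, g6⟩ := hu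
    obtain ⟨p', i', b', c', m', n', g1', g2', g3', g4', g5', g6'⟩ := hv
    have hc : c = 0 := by omega
    have hc' : c' = 0 := by omega
    subst hc hc'
    have hm : m = 0 := by omega
    have hm' : m' = 0 := by omega
    subst hm hm'
    have e : (D + 1) * i + b = (D + 1) * i' + b' := by omega
    have q1 : b % (D + 1) = b' % (D + 1) := by
      have := congrArg (· % (D + 1)) e
      simpa [Nat.add_mod] using this
    rw [Nat.mod_eq_of_lt (by omega), Nat.mod_eq_of_lt (by omega)] at q1
    omega
  refine ⟨0, by omega, mk (u 0 + 1) (u 1 - 1) (u 2) (u 3) 0 ?_ ?_ ?_ ?_ ?_ ?_ ?_ ?_ ?_⟩ <;>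
    (try simp) <;> omega

theorem mono_V (K : Type*) [Field K] (v : Fin 4 →₀ ℕ) :
    (monomial v (1 : K)) = X 0 ^ v 0 * X 1 ^ v 1 * X 2 ^ v 2 * X 3 ^ v 3 := by
  rw [monomial_eq, Finsupp.prod_fintype _ _ (by simp)]
  simp [Fin.prod_univ_four]

theorem mono_V' (K : Type*) [Field K] (a b c e : ℕ) :
    (monomial (V a b c e) (1 : K)) = X 0 ^ a * X 1 ^ b * X 2 ^ c * X 3 ^ e := by
  rw [mono_V]; rfl

theorem pow_eq (K : Type*) [Field K] (D : ℕ) (k : ℕ) :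
    (Ideal.span
      ({X 0 * X 2 ^ (D + 1), X 0 * X 3 ^ (D + 1), X 1 * X 2 ^ D * X 3} ∪
        {w | ∃ i j : ℕ, i + j = D + 2 ∧ w = X 2 ^ i * X 3 ^ j}) :
        Ideal (MvPolynomial (Fin 4) K)) ^ k =
      Ideal.span ((fun v => monomial v (1 : K)) '' GG D k) := by
  induction k with
  | zero =>
    rw [pow_zero, Ideal.one_eq_top, eq_comm, Ideal.eq_top_iff_one]
    refine Ideal.subset_span ⟨0, ⟨0, 0, 0, 0, 0, 0, by simp⟩, by simp⟩
  | succ k ih =>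
    rw [pow_succ, ih, Ideal.span_mul_span']
    congr 1
    ext f
    rw [Set.mem_mul]
    constructor
    · rintro ⟨_, ⟨v, ⟨p, i, b, c, m, n, h1, h2, h3, h4, h5, h6⟩, rfl⟩, g, hg, rfl⟩
      simp only
      rw [mono_V, h3, h4, h5, h6]
      rcases hg with (rfl | rfl | rfl) | ⟨s, t, hst, rfl⟩
      · refine ⟨V (p + 1 + i) b ((D + 1) * (p + 1) + D * b + n) ((D + 1) * i + b + m),
          ⟨p + 1, i, b, c, m, n, by omega, h2, rfl, rfl, rfl, rfl⟩, ?_⟩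
        simp only [mono_V']; ring
      · refine ⟨V (p + (i + 1)) b ((D + 1) * p + D * b + n) ((D + 1) * (i + 1) + b + m),
          ⟨p, i + 1, b, c, m, n, by omega, h2, rfl, rfl, rfl, rfl⟩, ?_⟩
        simp only [mono_V']; ring
      · refine ⟨V (p + i) (b + 1) ((D + 1) * p + D * (b + 1) + n) ((D + 1) * i + (b + 1) + m),
          ⟨p, i, b + 1, c, m, n, by omega, h2, rfl, rfl, rfl, rfl⟩, ?_⟩
        simp only [mono_V']; ring
      · refine ⟨V (p + i) b ((D + 1) * p + D * b + (n + s)) ((D + 1) * i + b + (m + t)),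
          ⟨p, i, b, c + 1, m + t, n + s, by omega, by rw [mul_add]; omega, rfl, rfl, rfl, rfl⟩, ?_⟩
        simp only [mono_V']; ring
    · rintro ⟨v, ⟨p, i, b, c, m, n, h1, h2, h3, h4, h5, h6⟩, rfl⟩
      simp only
      rw [mono_V, h3, h4, h5, h6]
      rcases p with _ | p
      · rcases i with _ | i
        · rcases b with _ | b
          · rcases c with _ | c
            · omega
            · obtain ⟨s, t, m', n', hst, hm, hn⟩ : ∃ s t m' n', s + t = D + 2 ∧ m = m' + t ∧
                  n = n' + s := by
                rw [mul_add] at h2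
                refine ⟨min n (D + 2), D + 2 - min n (D + 2), m - (D + 2 - min n (D + 2)),
                  n - min n (D + 2), ?_, ?_, ?_⟩ <;> omega
              refine ⟨_, ⟨V 0 0 n' m', ⟨0, 0, 0, c, m', n', by omega,
                by rw [mul_add] at h2; omega, rfl, rfl, by simp [V], by simp [V]⟩, rfl⟩,
                X 2 ^ s * X 3 ^ t, Or.inr ⟨s, t, hst, rfl⟩, ?_⟩
              simp only [mono_V', hm, hn]; ring
          · refine ⟨_, ⟨V (0 + 0) b ((D + 1) * 0 + D * b + n) ((D + 1) * 0 + b + m),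
              ⟨0, 0, b, c, m, n, by omega, h2, rfl, rfl, rfl, rfl⟩, rfl⟩,
              X 1 * X 2 ^ D * X 3, by simp, ?_⟩
            simp only [mono_V']; ring
        · refine ⟨_, ⟨V (0 + i) b ((D + 1) * 0 + D * b + n) ((D + 1) * i + b + m),
            ⟨0, i, b, c, m, n, by omega, h2, rfl, rfl, rfl, rfl⟩, rfl⟩,
            X 0 * X 3 ^ (D + 1), by simp, ?_⟩
          simp only [mono_V']; ring
      · refine ⟨_, ⟨V (p + i) b ((D + 1) * p + D * b + n) ((D + 1) * i + b + m),
          ⟨p, i, b, c, m, n, by omega, h2, rfl, rfl, rfl, rfl⟩, rfl⟩,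
          X 0 * X 2 ^ (D + 1), by simp, ?_⟩
        simp only [mono_V']; ring

theorem exists_order {α L : Type*} [LinearOrder L] {G : Set α} (hG : G.Finite) (r : α → L)
    (hr : Set.InjOn r G) : ∃ (s : ℕ) (u : Fin s → α), Function.Injective u ∧ Set.range u = G ∧
      ∀ i j, j < i ↔ r (u j) < r (u i) := by
  letI : Fintype G := hG.fintype
  letI : LinearOrder G := LinearOrder.lift' (fun x : G => r x.1) (Set.injOn_iff_injective.1 hr)
  let e := monoEquivOfFin G rfl
  refine ⟨_, fun i => (e i).1, ?_, ?_, ?_⟩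
  · exact Subtype.val_injective.comp e.injective
  · ext x
    constructor
    · rintro ⟨i, rfl⟩; exact (e i).2
    · intro hx; exact ⟨e.symm ⟨x, hx⟩, by simp⟩
  · intro i j
    rw [← e.lt_iff_lt]; rfl

theorem min_gens (K : Type*) [Field K] (D k : ℕ) :
    ((fun v => monomial v (1 : K)) '' GG D k) =
    {f | (∃ v : Fin 4 →₀ ℕ, f = monomial v (1 : K)) ∧
      f ∈ Ideal.span ((fun v => monomial v (1 : K)) '' GG D k) ∧
      f ∉ Ideal.span (Set.range (X : Fin 4 → MvPolynomial (Fin 4) K)) *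
        Ideal.span ((fun v => monomial v (1 : K)) '' GG D k)} := by
  ext f
  constructor
  · rintro ⟨v, hv, rfl⟩
    refine ⟨⟨v, rfl⟩, Ideal.subset_span ⟨v, hv, rfl⟩, ?_⟩
    intro hmem
    have hle : Ideal.span (Set.range (X : Fin 4 → MvPolynomial (Fin 4) K)) *
        Ideal.span ((fun v => monomial v (1 : K)) '' GG D k) ≤
        Ideal.span ((fun v => monomial v (1 : K)) ''
          {w | k * (D + 2) < w 0 + w 1 + w 2 + w 3}) := by
      rw [Ideal.span_mul_span', Ideal.span_le]
      rintro _ ⟨_, ⟨y, rfl⟩, _, ⟨w, hw, rfl⟩, rfl⟩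
      refine Ideal.subset_span ⟨Finsupp.single y 1 + w, ?_, ?_⟩
      · have := (GG_prop hw).2.1
        fin_cases y <;> (try simp) <;> omega
      · simp [X, monomial_mul]
    have h := hle hmem
    rw [mem_ideal_span_monomial_image] at h
    obtain ⟨w, hw, hwv⟩ := h v (by simp [mem_support_iff])
    have := (GG_prop hv).2.1
    have h0 := hwv 0
    have h1 := hwv 1
    have h2 := hwv 2
    have h3 := hwv 3
    simp only [Set.mem_setOf_eq] at hw
    omega
  · rintro ⟨⟨v, rfl⟩, h1, h2⟩
    rw [mem_ideal_span_monomial_image] at h1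
    obtain ⟨w, hw, hwv⟩ := h1 v (by simp [mem_support_iff])
    refine ⟨w, hw, ?_⟩
    by_cases hEq : w = v
    · rw [hEq]
    exfalso
    apply h2
    obtain ⟨c, rfl⟩ := exists_add_of_le hwv
    have hc : c ≠ 0 := by
      rintro rfl; simp at hEq
    obtain ⟨y, hy⟩ := Finsupp.ne_iff.1 hc
    have : (monomial (w + c) (1 : K)) = monomial c 1 * monomial w 1 := by
      rw [monomial_mul, add_comm, one_mul]
    rw [this]
    refine Ideal.mul_mem_mul ?_ (Ideal.subset_span ⟨w, hw, rfl⟩)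
    rw [← Set.image_univ, mem_ideal_span_X_image]
    intro m hm
    have : m = c := by
      classical
      rw [support_monomial] at hm
      simpa using hm
    exact ⟨y, trivial, by rw [this]; simpa using hy⟩

theorem colon_eq (K : Type*) [Field K] (A : Set (Fin 4 →₀ ℕ)) (u : Fin 4 →₀ ℕ)
    (h : ∀ v ∈ A, ∃ y, u y < v y ∧ ∃ w ∈ A, w ≤ u + Finsupp.single y 1) :
    ∃ S ⊆ Set.range (X : Fin 4 → MvPolynomial (Fin 4) K),
      Submodule.colon (Ideal.span ((fun v => monomial v (1 : K)) '' A))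
        (Ideal.span {monomial u (1 : K)} : Ideal (MvPolynomial (Fin 4) K)) = Ideal.span S := by
  refine ⟨X '' {y | ∃ w ∈ A, w ≤ u + Finsupp.single y 1}, Set.image_subset_range _ _, ?_⟩
  apply le_antisymm
  · intro f hf
    rw [Submodule.mem_colon] at hf
    have h1 := hf _ (Ideal.subset_span (Set.mem_singleton _))
    rw [smul_eq_mul, mem_ideal_span_monomial_image] at h1
    rw [mem_ideal_span_X_image]
    intro m hm
    obtain ⟨v, hv, hvle⟩ := h1 (m + u) (by
      rw [mem_support_iff, coeff_mul_monomial, mul_one]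
      exact mem_support_iff.1 hm)
    obtain ⟨y, hy, hw⟩ := h v hv
    refine ⟨y, hw, ?_⟩
    have := hvle y
    simp at this
    omega
  · rw [Ideal.span_le]
    rintro _ ⟨y, ⟨w, hw, hwle⟩, rfl⟩
    rw [SetLike.mem_coe, Submodule.mem_colon]
    intro p hp
    obtain ⟨q, rfl⟩ := Ideal.mem_span_singleton'.1 hp
    rw [smul_eq_mul, mul_left_comm]
    apply Ideal.mul_mem_left
    obtain ⟨c, hc⟩ := exists_add_of_le hwle
    have : (X y * monomial u (1 : K)) = monomial c 1 * monomial w 1 := by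
      rw [monomial_mul, add_comm c, ← hc, X, monomial_mul, add_comm]
    rw [this]
    exact Ideal.mul_mem_left _ _ (Ideal.subset_span ⟨w, hw, rfl⟩)


/-- Let `K` be a field and `d > 1`.  In `R = K[x₁,x₂,z₁,z₂]`
(with `x₁ = X 0`, `x₂ = X 1`, `z₁ = X 2`, `z₂ = X 3`), let
`J = (x₁z₁^d, x₁z₂^d, x₂z₁^{d-1}z₂) + (z₁,z₂)^{d+1}`.  For every `1 ≤ k < d` the
ideal `J^k` has linear quotients: there is an ordering `u₁, …, u_s` of the minimal
monomial generators of `J^k` (the monic monomials lying in `J^k` but not in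
`𝔪·J^k`, `𝔪` being the ideal of the variables) such that for each `i` the colon
ideal `(u₁, …, u_{i-1}) : (u_i)` is generated by a subset of the variables. -/
theorem stmt0 (K : Type*) [Field K] (d : ℕ) (hd : 1 < d)
    (J : Ideal (MvPolynomial (Fin 4) K))
    (hJ : J = Ideal.span
      ({X 0 * X 2 ^ d, X 0 * X 3 ^ d, X 1 * X 2 ^ (d - 1) * X 3} ∪
        {w | ∃ i j : ℕ, i + j = d + 1 ∧ w = X 2 ^ i * X 3 ^ j})) :
    ∀ k : ℕ, 1 ≤ k → k < d →
      ∃ (s : ℕ) (u : Fin s → MvPolynomial (Fin 4) K),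
        Function.Injective u ∧
        Set.range u =
          {f | (∃ v : Fin 4 →₀ ℕ, f = monomial v (1 : K)) ∧ f ∈ J ^ k ∧
            f ∉ Ideal.span (Set.range (X : Fin 4 → MvPolynomial (Fin 4) K)) * J ^ k} ∧
        ∀ i : Fin s,
          ∃ S ⊆ Set.range (X : Fin 4 → MvPolynomial (Fin 4) K),
            Submodule.colon (Ideal.span {g | ∃ j : Fin s, j < i ∧ g = u j})
              (Ideal.span {u i}) = Ideal.span S := by

  intro k _ hk
  obtain ⟨D, rfl⟩ : ∃ D, d = D + 1 := ⟨d - 1, by omega⟩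
  simp only [Nat.add_sub_cancel] at hJ
  have hp : J ^ k = Ideal.span ((fun v => monomial v (1 : K)) '' GG D k) := by
    rw [hJ]; exact pow_eq K D k
  obtain ⟨s, u, hinj, hrange, hlt⟩ := exists_order (GG_fin D k) rk (rk_inj D k)
  have hu : ∀ i, u i ∈ GG D k := fun i => hrange ▸ Set.mem_range_self i
  refine ⟨s, fun i => monomial (u i) (1 : K), ?_, ?_, ?_⟩
  · exact (monomial_left_injective one_ne_zero).comp hinj
  · rw [hp, ← min_gens, ← hrange, ← Set.range_comp]; rfl
  · intro i
    have hset : {g | ∃ j : Fin s, j < i ∧ g = monomial (u j) (1 : K)} =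
        (fun v => monomial v (1 : K)) '' (u '' {j | j < i}) := by
      ext g
      simp [eq_comm]
    rw [hset]
    apply colon_eq
    rintro _ ⟨j, hj, rfl⟩
    obtain ⟨y, hy, w, hw, hwr, hle⟩ := crit (by omega) (hu i) (hu j) ((hlt i j).1 hj)
    refine ⟨y, hy, w, ?_, hle⟩
    rw [← hrange] at hw
    obtain ⟨l, rfl⟩ := hw
    exact ⟨l, (hlt i l).2 hwr, rfl⟩
end

section
/- Let K be a field and d > 1 an integer. With u = (z₁^{d−1}z₂x₂)^d and V the ideal generated by all d-fold products of elements of G that are different from u, one has x₁^d · u ∈ V; explicitly, x₁^d u = x₂^d (z₁^d x₁)^{d−1} (z₂^d x₁), which is a d-fold product of elements of G not equal to u times a monomial. In particular x₁^d belongs to the colon ideal V : (u). -/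
open MvPolynomial

/-- Let `K` be a field, `d > 1`.  In `R = K[x₁,x₂,z₁,z₂]`
(with `x₁ = X 0`, `x₂ = X 1`, `z₁ = X 2`, `z₂ = X 3`), let `G` be the set of
monomials `x₁z₁^d, x₁z₂^d, x₂z₁^{d-1}z₂` together with all monomials of degree
`d+1` in `z₁, z₂` (the minimal monomial generators of
`J = (x₁z₁^d, x₁z₂^d, x₂z₁^{d-1}z₂) + (z₁,z₂)^{d+1}`).  Set
`u = (z₁^{d-1}z₂x₂)^d` and let `V` be the ideal generated by all `d`-fold
products of elements of `G` that are different from `u`.  Then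
`x₁^d·u = x₂^d·(z₁^d x₁)^{d-1}·(z₂^d x₁)`, a `d`-fold product of elements of `G`
not equal to `u` times a monomial; hence `x₁^d·u ∈ V` and `x₁^d ∈ V : (u)`. -/
theorem stmt1 (K : Type*) [Field K] (d : ℕ) (hd : 1 < d)
    (G : Set (MvPolynomial (Fin 4) K))
    (hG : G = {X 0 * X 2 ^ d, X 0 * X 3 ^ d, X 1 * X 2 ^ (d - 1) * X 3} ∪
      {w | ∃ i j : ℕ, i + j = d + 1 ∧ w = X 2 ^ i * X 3 ^ j})
    (u : MvPolynomial (Fin 4) K) (hu : u = (X 2 ^ (d - 1) * X 3 * X 1) ^ d)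
    (V : Ideal (MvPolynomial (Fin 4) K))
    (hV : V = Ideal.span
      {w | ∃ g : Fin d → MvPolynomial (Fin 4) K,
        (∀ i, g i ∈ G) ∧ w = ∏ i, g i ∧ w ≠ u}) :
    (X 0 ^ d * u =
        X 1 ^ d * ((X 0 * X 2 ^ d) ^ (d - 1) * (X 0 * X 3 ^ d)) ∧
      ∃ g : Fin d → MvPolynomial (Fin 4) K,
        (∀ i, g i ∈ G) ∧ (∏ i, g i) ≠ u ∧
          X 0 ^ d * u = X 1 ^ d * ∏ i, g i) ∧
    X 0 ^ d * u ∈ V ∧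
    X 0 ^ d ∈ Submodule.colon V (Ideal.span {u}) := by
  obtain ⟨n, rfl⟩ : ∃ n, d = n + 1 := ⟨d - 1, by omega⟩
  simp only [Nat.add_sub_cancel] at *
  have h1 : X 0 ^ (n + 1) * u =
      X 1 ^ (n + 1) * ((X 0 * X 2 ^ (n + 1)) ^ n * (X 0 * X 3 ^ (n + 1))) := by
    rw [hu]
    simp only [mul_pow, ← pow_mul]
    rw [mul_comm (n + 1) n]
    ring
  have hne : (X 0 * X 2 ^ (n + 1)) ^ n * (X 0 * X 3 ^ (n + 1)) ≠ u := by
    intro h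
    rw [hu] at h
    have := congrArg (MvPolynomial.eval (fun i : Fin 4 => if i = 0 then (0 : K) else 1)) h
    simp at this
  have h2 : ∃ g : Fin (n + 1) → MvPolynomial (Fin 4) K,
      (∀ i, g i ∈ G) ∧
        ∏ i, g i = (X 0 * X 2 ^ (n + 1)) ^ n * (X 0 * X 3 ^ (n + 1)) := by
    refine ⟨Fin.cons (X 0 * X 3 ^ (n + 1)) (fun _ => X 0 * X 2 ^ (n + 1)), ?_, ?_⟩
    · intro i
      rw [hG]
      refine Fin.cases ?_ (fun j => ?_) i
      · left; simp
      · left; simp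
    · rw [Fin.prod_univ_succ]
      simp [mul_comm]
  obtain ⟨g, hg, hp⟩ := h2
  have h3 : X 0 ^ (n + 1) * u ∈ V := by
    rw [h1, hV]
    exact Ideal.mul_mem_left _ _ (Ideal.subset_span ⟨g, hg, hp.symm, hne⟩)
  refine ⟨⟨h1, g, hg, hp ▸ hne, hp ▸ h1⟩, h3, ?_⟩
  rw [Submodule.mem_colon]
  intro p hpm
  obtain ⟨a, rfl⟩ := Ideal.mem_span_singleton'.1 hpm
  rw [smul_eq_mul, mul_left_comm]
  exact Ideal.mul_mem_left _ _ h3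
end

section
/- Let K be a field and d > 1 an integer. With u = (z₁^{d−1}z₂x₂)^d and V the ideal generated by all d-fold products of elements of G that are different from u, for every integer s with 0 ≤ s < d one has x₁^s · u ∉ V. Consequently x₁^d is a minimal generator of the colon ideal V : (u), and the ideal J^d has a first syzygy of degree d (so J^d does not have a linear resolution). -/
open MvPolynomial


theorem h_comb (d : ℕ) (hd : 1 < d) (s : ℕ) (hs : s < d) (e : Fin d → (Fin 4 →₀ ℕ))
    (he : ∀ i, (e i 0 = 1 ∧ e i 1 = 0 ∧ e i 2 = d ∧ e i 3 = 0) ∨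
      (e i 0 = 1 ∧ e i 1 = 0 ∧ e i 2 = 0 ∧ e i 3 = d) ∨
      (e i 0 = 0 ∧ e i 1 = 1 ∧ e i 2 = d - 1 ∧ e i 3 = 1) ∨ e i 2 + e i 3 = d + 1)
    (h0 : ∑ i, e i 0 ≤ s) (h2 : ∑ i, e i 2 ≤ d * (d - 1)) (h3 : ∑ i, e i 3 ≤ d) :
    ∀ i, e i 0 = 0 ∧ e i 1 = 1 ∧ e i 2 = d - 1 ∧ e i 3 = 1 := by
  have hz : ∀ i, e i 2 + e i 3 = d := by
    have hle : ∀ i ∈ Finset.univ, d ≤ e i 2 + e i 3 := by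
      intro i _
      rcases he i with h | h | h | h <;> omega
    have hsum : ∑ i : Fin d, d = ∑ i, (e i 2 + e i 3) := by
      apply le_antisymm (Finset.sum_le_sum hle)
      rw [Finset.sum_add_distrib]
      simp only [Finset.sum_const, Finset.card_univ, Fintype.card_fin, smul_eq_mul]
      have : d * d = d * (d - 1) + d := by
        obtain ⟨k, rfl⟩ : ∃ k, d = k + 1 := ⟨d - 1, by omega⟩
        simp; ring
      omega
    intro i
    exact ((Finset.sum_eq_sum_iff_of_le hle).1 hsum i (Finset.mem_univ i)).symm
  have he1 : ∀ i, (e i 0 = 1 ∧ e i 1 = 0 ∧ e i 2 = d ∧ e i 3 = 0) ∨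
      (e i 0 = 1 ∧ e i 1 = 0 ∧ e i 2 = 0 ∧ e i 3 = d) ∨
      (e i 0 = 0 ∧ e i 1 = 1 ∧ e i 2 = d - 1 ∧ e i 3 = 1) := by
    intro i
    have := hz i
    rcases he i with h | h | h | h
    · exact Or.inl h
    · exact Or.inr (Or.inl h)
    · exact Or.inr (Or.inr h)
    · omega
  obtain ⟨c, hc⟩ : ∃ c, e c 0 = 0 := by
    by_contra! hcon
    have : ∑ i : Fin d, 1 ≤ ∑ i, e i 0 :=
      Finset.sum_le_sum fun i _ => Nat.one_le_iff_ne_zero.2 (hcon i)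
    simp at this
    omega
  have hc3 : e c 3 = 1 := by rcases he1 c with h | h | h <;> omega
  have hb : ∀ i, d - 1 ≤ e i 2 := by
    intro i
    rcases he1 i with h | h | h
    · omega
    · exfalso
      have hne : i ≠ c := by rintro rfl; omega
      have := Finset.sum_le_sum_of_subset (f := fun i => e i 3)
        (Finset.subset_univ ({i, c} : Finset (Fin d)))
      rw [Finset.sum_pair hne] at this
      omega
    · omega
  have h22 : ∑ i : Fin d, (d - 1) = ∑ i, e i 2 := by
    apply le_antisymm (Finset.sum_le_sum fun i _ => hb i)
    simpa using h2
  intro i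
  have := (Finset.sum_eq_sum_iff_of_le fun i _ => hb i).1 h22 i (Finset.mem_univ i)
  rcases he1 i with h | h | h
  · omega
  · omega
  · exact h

theorem h_mono (K : Type*) [Field K] (a b c e : ℕ) :
    (X 0 ^ a * X 1 ^ b * X 2 ^ c * X 3 ^ e : MvPolynomial (Fin 4) K) =
      monomial (Finsupp.single 0 a + Finsupp.single 1 b + Finsupp.single 2 c +
        Finsupp.single 3 e) 1 := by
  simp [X_pow_eq_monomial, monomial_mul]

theorem h_exp (n : Fin 4 →₀ ℕ) (a b c e : ℕ) (h0 : n 0 = a) (h1 : n 1 = b) (h2 : n 2 = c)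
    (h3 : n 3 = e) : n = Finsupp.single 0 a + Finsupp.single 1 b + Finsupp.single 2 c +
        Finsupp.single 3 e := by
  ext i
  fin_cases i <;> simp [Finsupp.single_apply, *]

theorem h_single {t : Fin 4 →₀ ℕ} {r : Fin 4 →₀ ℕ} {s : ℕ}
    (h : t + r = Finsupp.single 0 s) : r = Finsupp.single 0 (r 0) ∧ t = Finsupp.single 0 (t 0)
      ∧ t 0 + r 0 = s := by
  have h' : ∀ i, t i + r i = Finsupp.single 0 s i := fun i => by rw [← h]; rfl
  have a0 := h' 0
  have a1 := h' 1
  have a2 := h' 2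
  have a3 := h' 3
  simp [Finsupp.single_apply] at a0 a1 a2 a3
  refine ⟨?_, ?_, a0⟩ <;> ext i <;> fin_cases i <;> simp [Finsupp.single_apply, *]

/-- Let `K` be a field, `d > 1`.  In `R = K[x₁,x₂,z₁,z₂]`
(with `x₁ = X 0`, `x₂ = X 1`, `z₁ = X 2`, `z₂ = X 3`), let `G` be the set of
monomials `x₁z₁^d, x₁z₂^d, x₂z₁^{d-1}z₂` together with all monomials of degree
`d+1` in `z₁, z₂`, let `u = (z₁^{d-1}z₂x₂)^d`, and let `V` be the ideal
generated by all `d`-fold products of elements of `G` different from `u`.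
Then for every `s < d` one has `x₁^s·u ∉ V`; consequently `x₁^d` is a minimal
generator of the colon ideal `Q = V : (u)` (it lies in `Q`, is homogeneous of
degree `d`, and does not lie in `𝔪·Q` where `𝔪` is the ideal of the variables),
so `Q` has a minimal generator of degree `d`; in particular `Q` is not generated
by linear forms — i.e. `J^d` has a first syzygy of degree `d` and hence does not
have a linear resolution. -/
theorem stmt2 (K : Type*) [Field K] (d : ℕ) (hd : 1 < d)
    (G : Set (MvPolynomial (Fin 4) K))
    (hG : G = {X 0 * X 2 ^ d, X 0 * X 3 ^ d, X 1 * X 2 ^ (d - 1) * X 3} ∪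
      {w | ∃ i j : ℕ, i + j = d + 1 ∧ w = X 2 ^ i * X 3 ^ j})
    (u : MvPolynomial (Fin 4) K) (hu : u = (X 2 ^ (d - 1) * X 3 * X 1) ^ d)
    (V : Ideal (MvPolynomial (Fin 4) K))
    (hV : V = Ideal.span
      {w | ∃ g : Fin d → MvPolynomial (Fin 4) K,
        (∀ i, g i ∈ G) ∧ w = ∏ i, g i ∧ w ≠ u}) :
    (∀ s : ℕ, s < d → X 0 ^ s * u ∉ V) ∧
    (X 0 ^ d ∈ Submodule.colon V (Ideal.span {u}) ∧
      X 0 ^ d ∉ Ideal.span (Set.range (X : Fin 4 → MvPolynomial (Fin 4) K)) *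
        Submodule.colon V (Ideal.span {u})) ∧
    (∃ f : MvPolynomial (Fin 4) K, f.IsHomogeneous d ∧
      f ∈ Submodule.colon V (Ideal.span {u}) ∧
      f ∉ Ideal.span (Set.range (X : Fin 4 → MvPolynomial (Fin 4) K)) *
        Submodule.colon V (Ideal.span {u})) ∧
    ¬∃ S : Set (MvPolynomial (Fin 4) K), (∀ g ∈ S, g.IsHomogeneous 1) ∧
      Submodule.colon V (Ideal.span {u}) = Ideal.span S := by
  have hu' : u = monomial (Finsupp.single 0 0 + Finsupp.single 1 d +
      Finsupp.single 2 (d * (d - 1)) + Finsupp.single 3 d) 1 := by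
    rw [hu, ← h_mono]
    rw [mul_pow, mul_pow, ← pow_mul]
    ring
  have hGe : ∀ g ∈ G, ∃ e : Fin 4 →₀ ℕ, g = monomial e 1 ∧
      ((e 0 = 1 ∧ e 1 = 0 ∧ e 2 = d ∧ e 3 = 0) ∨
      (e 0 = 1 ∧ e 1 = 0 ∧ e 2 = 0 ∧ e 3 = d) ∨
      (e 0 = 0 ∧ e 1 = 1 ∧ e 2 = d - 1 ∧ e 3 = 1) ∨ e 2 + e 3 = d + 1) := by
    intro g hg
    rw [hG] at hg
    rcases hg with (rfl | rfl | rfl) | ⟨i, j, hij, rfl⟩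
    · refine ⟨_, Eq.trans ?_ (h_mono K 1 0 d 0), Or.inl ?_⟩
      · ring
      · simp [Finsupp.single_apply]
    · refine ⟨_, Eq.trans ?_ (h_mono K 1 0 0 d), Or.inr (Or.inl ?_)⟩
      · ring
      · simp [Finsupp.single_apply]
    · refine ⟨_, Eq.trans ?_ (h_mono K 0 1 (d - 1) 1), Or.inr (Or.inr (Or.inl ?_))⟩
      · ring
      · simp [Finsupp.single_apply]
    · refine ⟨_, Eq.trans ?_ (h_mono K 0 0 i j), Or.inr (Or.inr (Or.inr ?_))⟩
      · ring
      · simpa [Finsupp.single_apply] using hij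
  have hVle : V ≤ Ideal.span ((fun e => monomial e (1 : K)) ''
      {e : Fin 4 →₀ ℕ | ∀ s < d, ¬ e ≤ Finsupp.single 0 s + (Finsupp.single 0 0 +
        Finsupp.single 1 d + Finsupp.single 2 (d * (d - 1)) + Finsupp.single 3 d)}) := by
    rw [hV, Ideal.span_le]
    rintro w ⟨g, hg, rfl, hne⟩
    choose e he hE using fun i => hGe (g i) (hg i)
    have hprod : ∏ i, g i = monomial (∑ i, e i) (1 : K) := by
      simp_rw [he]
      rw [monomial_sum_one]
    apply Ideal.subset_span
    refine ⟨∑ i, e i, ?_, hprod.symm⟩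
    intro s hs hle
    have b0 := hle 0
    have b2 := hle 2
    have b3 := hle 3
    simp [Finsupp.single_apply, Finsupp.finsetSum_apply] at b0 b2 b3
    have key := h_comb d hd s hs e hE b0 b2 b3
    apply hne
    rw [hprod, hu']
    refine congrArg (fun n => monomial n (1 : K)) ?_
    apply h_exp
    · simp [Finsupp.finsetSum_apply, key]
    · simp [Finsupp.finsetSum_apply, key]
    · simp [Finsupp.finsetSum_apply, key]
    · simp [Finsupp.finsetSum_apply, key]
  have hfu : ∀ f : MvPolynomial (Fin 4) K, f * u ∈ V → ∀ s < d,
      coeff (Finsupp.single 0 s) f = 0 := by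
    intro f hf s hs
    by_contra hne
    have h1 := mem_ideal_span_monomial_image.1 (hVle hf)
    have h2 := h1 (Finsupp.single 0 s + (Finsupp.single 0 0 +
        Finsupp.single 1 d + Finsupp.single 2 (d * (d - 1)) + Finsupp.single 3 d)) (by
      rw [mem_support_iff, hu', coeff_mul_monomial, mul_one]
      exact hne)
    obtain ⟨e, he, hle⟩ := h2
    exact he s hs hle
  have hcol : ∀ f : MvPolynomial (Fin 4) K,
      f ∈ Submodule.colon V (Ideal.span {u}) ↔ f * u ∈ V := by
    intro f
    rw [Submodule.mem_colon]
    constructor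
    · intro h
      exact h u (Ideal.subset_span rfl)
    · intro h p hp
      obtain ⟨a, rfl⟩ := Ideal.mem_span_singleton'.1 hp
      rw [smul_eq_mul, mul_left_comm]
      exact V.mul_mem_left a h
  have hX : ∀ s : ℕ, (X 0 ^ s : MvPolynomial (Fin 4) K) = monomial (Finsupp.single 0 s) 1 :=
    fun s => X_pow_eq_monomial
  have hA : ∀ s : ℕ, s < d → X 0 ^ s * u ∉ V := by
    intro s hs h
    have := hfu _ h s hs
    rw [hX] at this
    simp at this
  have hB : X 0 ^ d ∈ Submodule.colon V (Ideal.span {u}) := by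
    rw [hcol]
    obtain ⟨k, rfl⟩ : ∃ k, d = k + 1 := ⟨d - 1, by omega⟩
    have : (X 0 ^ (k + 1) * u : MvPolynomial (Fin 4) K) = X 1 ^ (k + 1) *
        ((X 0 * X 3 ^ (k + 1)) * (X 0 * X 2 ^ (k + 1)) ^ k) := by
      rw [hu]
      simp only [Nat.add_sub_cancel, mul_pow, ← pow_mul]
      ring
    rw [this]
    apply V.mul_mem_left
    rw [hV]
    apply Ideal.subset_span
    refine ⟨Fin.cons (X 0 * X 3 ^ (k + 1)) (fun _ => X 0 * X 2 ^ (k + 1)), ?_, ?_, ?_⟩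
    · intro i
      rw [hG]
      refine Fin.cases ?_ (fun j => ?_) i <;> simp
    · simp [Fin.prod_univ_succ]
    · intro h
      have h' := congrArg (MvPolynomial.eval (fun i : Fin 4 => if i = 1 then (0 : K) else 1)) h
      rw [hu] at h'
      simp at h'
  have hC : X 0 ^ d ∉ Ideal.span (Set.range (X : Fin 4 → MvPolynomial (Fin 4) K)) *
        Submodule.colon V (Ideal.span {u}) := by
    intro h
    have : coeff (Finsupp.single 0 d) (X 0 ^ d : MvPolynomial (Fin 4) K) = 0 := by
      refine Submodule.mul_induction_on h ?_ ?_
      · intro m hm q hq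
        have hm0 : coeff 0 m = 0 := by
          have hle : Ideal.span (Set.range (X : Fin 4 → MvPolynomial (Fin 4) K)) ≤
              RingHom.ker (constantCoeff : MvPolynomial (Fin 4) K →+* K) := by
            rw [Ideal.span_le]
            rintro _ ⟨i, rfl⟩
            simp [RingHom.mem_ker]
          exact hle hm
        rw [coeff_mul]
        apply Finset.sum_eq_zero
        rintro ⟨a, b⟩ hab
        obtain ⟨hb, ha, hs⟩ := h_single (Finset.HasAntidiagonal.mem_antidiagonal.1 hab)
        simp only at hb ha hs ⊢
        rcases Nat.lt_or_ge (b 0) d with hlt | hge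
        · rw [hb, hfu q ((hcol q).1 hq) _ hlt, mul_zero]
        · have : a 0 = 0 := by omega
          rw [ha, this, Finsupp.single_zero, hm0, zero_mul]
      · intro x y hx hy
        rw [coeff_add, hx, hy, add_zero]
    rw [hX] at this
    simp at this
  refine ⟨hA, ⟨hB, hC⟩, ⟨X 0 ^ d, ?_, hB, hC⟩, ?_⟩
  · exact isHomogeneous_X_pow 0 d
  · rintro ⟨S, hS, hQ⟩
    have hB' := hB
    rw [hQ] at hB'
    have : ∀ s, coeff (Finsupp.single 0 s) (X 0 ^ d : MvPolynomial (Fin 4) K) = 0 := by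
      refine Submodule.span_induction (p := fun f _ => ∀ s, coeff (Finsupp.single 0 s) f = 0)
        ?_ ?_ ?_ ?_ hB'
      · intro g hg s
        by_cases h1 : s = 1
        · have hgQ : g ∈ Submodule.colon V (Ideal.span {u}) := by
            rw [hQ]; exact Ideal.subset_span hg
          exact hfu g ((hcol g).1 hgQ) s (by omega)
        · apply (hS g hg).coeff_eq_zero
          simpa using h1
      · intro s; simp
      · intro x y _ _ hx hy s
        rw [coeff_add, hx, hy, add_zero]
      · intro a x _ hx s
        rw [smul_eq_mul, coeff_mul]
        apply Finset.sum_eq_zero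
        rintro ⟨a', b⟩ hab
        obtain ⟨hb, -, -⟩ := h_single (Finset.HasAntidiagonal.mem_antidiagonal.1 hab)
        simp only at hb ⊢
        rw [hb, hx, mul_zero]
    have := this d
    rw [hX] at this
    simp at this
end

section
/- Assume the monomials m₁,…,m_k of degree d in the variables z₁,…,z_n are pseudo-linear of order p with respect to φ. Set J = (z₁,…,z_n)^{d+1} + (φ(t₁)m₁, φ(t₂)m₂, …, φ(t_k)m_k), an ideal of K[x₁,…,x_m, z₁,…,z_n]. Then for every integer a with 1 ≤ a ≤ p, the ideal J^a has linear quotients: there is an ordering u₁,…,u_s of its minimal monomial generators such that each colon ideal (u₁,…,u_{i−1}) : (u_i) is generated by a subset of the variables. -/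
open MvPolynomial

/-- The kernel `H` of the Rees presentation `Φ : K[z₁,…,z_n,t₁,…,t_k] → K[z₁,…,z_n,s]`,
`Φ(z_i) = z_i`, `Φ(t_i) = m_i s`, where the monomial `m_i` has exponent vector `μ i`.
The source is `MvPolynomial (Fin n ⊕ Fin k) K` (with `z_i = X (inl i)`,
`t_i = X (inr i)`) and the target is `MvPolynomial (Fin n ⊕ Unit) K`
(with `s = X (inr ())`). -/
noncomputable def reesKer (K : Type*) [Field K] (n k : ℕ) (μ : Fin k → (Fin n →₀ ℕ)) :
    Ideal (MvPolynomial (Fin n ⊕ Fin k) K) :=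
  RingHom.ker ((aeval (Sum.elim
    (fun i : Fin n => (X (Sum.inl i) : MvPolynomial (Fin n ⊕ Unit) K))
    (fun i : Fin k => monomial (Finsupp.mapDomain Sum.inl (μ i)) 1 * X (Sum.inr ())))) :
    MvPolynomial (Fin n ⊕ Fin k) K →ₐ[K] MvPolynomial (Fin n ⊕ Unit) K)

/-- `m₁, …, m_k` (monomials of degree `d` in `z₁, …, z_n`, given by their exponent
vectors `μ 1, …, μ k`) are *pseudo-linear of order `p`* with respect to
`φ : {t₁,…,t_k} → {x₁,…,x_m}`: for all `1 ≤ b ≤ a ≤ p` and every binomial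
`MA - NB ∈ H` with `M, N` monomials in the `z`'s of degree `(a-b)(d+1)` and `A, B`
monomials in the `t`'s of degree `b` such that `φ(A) > φ(B)` in the lexicographic
order (on monomials in `x₁ > x₂ > … > x_m`), there is a binomial `M₁t_i - N₁t_j ∈ H`
with `M₁, N₁` monomials in the `z`'s such that (1) `N₁ ∣ N`; (2) `t_i ∣ A`, `t_j ∣ B`;
(3) `φ(t_i) ∣ φ(A)/gcd(φ(A),φ(B))` (equivalently the exponent of `x_{φ i}` in `φ(A)`
exceeds that in `φ(B)`); (4) `φ(t_i) > φ(t_j)` lexicographically. -/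
def IsPseudoLinear (K : Type*) [Field K] (m n k d p : ℕ)
    (μ : Fin k → (Fin n →₀ ℕ)) (φ : Fin k → Fin m) : Prop :=
  ∀ a b : ℕ, 1 ≤ b → b ≤ a → a ≤ p →
    ∀ (M N : Fin n →₀ ℕ) (A B : Fin k →₀ ℕ),
      (M.sum fun _ e => e) = (a - b) * (d + 1) →
      (N.sum fun _ e => e) = (a - b) * (d + 1) →
      (A.sum fun _ e => e) = b →
      (B.sum fun _ e => e) = b →
      toLex (Finsupp.mapDomain φ B) < toLex (Finsupp.mapDomain φ A) →
      (monomial (Finsupp.mapDomain Sum.inl M + Finsupp.mapDomain Sum.inr A) (1 : K) -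
        monomial (Finsupp.mapDomain Sum.inl N + Finsupp.mapDomain Sum.inr B) 1) ∈
        reesKer K n k μ →
      ∃ (i j : Fin k) (M₁ N₁ : Fin n →₀ ℕ),
        (monomial (Finsupp.mapDomain Sum.inl M₁ +
            Finsupp.mapDomain Sum.inr (Finsupp.single i 1)) (1 : K) -
          monomial (Finsupp.mapDomain Sum.inl N₁ +
            Finsupp.mapDomain Sum.inr (Finsupp.single j 1)) 1) ∈
          reesKer K n k μ ∧
        N₁ ≤ N ∧
        1 ≤ A i ∧ 1 ≤ B j ∧
        (Finsupp.mapDomain φ B) (φ i) < (Finsupp.mapDomain φ A) (φ i) ∧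
        toLex (Finsupp.single (φ j) 1 : Fin m →₀ ℕ) <
          toLex (Finsupp.single (φ i) 1 : Fin m →₀ ℕ)

/-- abstract sorting lemma -/
theorem aux_linquot {K σ α : Type*} [Field K] [LinearOrder α]
    (G : Set (σ →₀ ℕ)) (hG : G.Finite) (key : (σ →₀ ℕ) → α) (hkey : Function.Injective key)
    (hex : ∀ u ∈ G, ∀ v ∈ G, key v < key u → ∃ w ∈ G, key w < key u ∧
      ∃ l, u l < v l ∧ w ≤ u + Finsupp.single l 1) :
    ∃ (s : ℕ) (u : Fin s → MvPolynomial σ K),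
      Function.Injective u ∧ Set.range u = (fun e => monomial e (1 : K)) '' G ∧
      ∀ i : Fin s, ∃ S ⊆ Set.range (X : σ → MvPolynomial σ K),
        Submodule.colon (Ideal.span {g | ∃ j : Fin s, j < i ∧ g = u j})
          (Ideal.span {u i}) = Ideal.span S := by
  classical
  let P : Finset α := hG.toFinset.image key
  let o := P.orderEmbOfFin rfl
  have ho : ∀ i, ∃ e ∈ G, key e = o i := by
    intro i
    have := P.orderEmbOfFin_mem rfl i
    obtain ⟨e, he, hek⟩ := Finset.mem_image.1 this
    exact ⟨e, hG.mem_toFinset.1 he, hek⟩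
  choose e heG hek using ho
  have hsurj : ∀ g ∈ G, ∃ i, e i = g := by
    intro g hg
    have h1 : key g ∈ Set.range o := by
      rw [P.range_orderEmbOfFin rfl]
      simpa [P] using ⟨g, hg, rfl⟩
    obtain ⟨i, hi⟩ := h1
    exact ⟨i, hkey (by rw [hek, hi])⟩
  have hlt : ∀ i j, key (e j) < key (e i) ↔ j < i := by
    intro i j
    rw [hek, hek]
    exact o.lt_iff_lt
  refine ⟨P.card, fun i => monomial (e i) 1, ?_, ?_, ?_⟩
  · intro i j hij
    have h1 : e i = e j := monomial_left_injective (one_ne_zero) hij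
    apply o.injective
    rw [← hek, ← hek, h1]
  · ext f
    constructor
    · rintro ⟨i, rfl⟩
      exact ⟨e i, heG i, rfl⟩
    · rintro ⟨g, hg, rfl⟩
      obtain ⟨i, rfl⟩ := hsurj g hg
      exact ⟨i, rfl⟩
  · intro i
    refine ⟨X '' {l | ∃ w ∈ G, key w < key (e i) ∧ w ≤ e i + Finsupp.single l 1},
      Set.image_subset_range _ _, ?_⟩
    have hset : {g | ∃ j : Fin P.card, j < i ∧ g = monomial (e j) (1 : K)} =
        (fun e => monomial e (1 : K)) '' {w | w ∈ G ∧ key w < key (e i)} := by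
      ext f
      constructor
      · rintro ⟨j, hj, rfl⟩
        exact ⟨e j, ⟨heG j, (hlt i j).2 hj⟩, rfl⟩
      · rintro ⟨w, ⟨hw, hwk⟩, rfl⟩
        obtain ⟨j, rfl⟩ := hsurj w hw
        exact ⟨j, (hlt i j).1 hwk, rfl⟩
    rw [hset]
    apply le_antisymm
    · intro f hf
      rw [Ideal.mem_colon_span_singleton, mem_ideal_span_monomial_image] at hf
      rw [mem_ideal_span_X_image]
      intro x hx
      obtain ⟨v, ⟨hv, hvk⟩, hvx⟩ := hf (x + e i) (by
        rw [mem_support_iff, coeff_mul_monomial, mul_one]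
        exact mem_support_iff.1 hx)
      obtain ⟨w, hw, hwk, l, hl, hwl⟩ := hex _ (heG i) v hv hvk
      refine ⟨l, ⟨w, hw, hwk, hwl⟩, ?_⟩
      have := hvx l
      simp only [Finsupp.add_apply] at this
      omega
    · rw [Ideal.span_le]
      rintro _ ⟨l, ⟨w, hw, hwk, hwl⟩, rfl⟩
      rw [SetLike.mem_coe, Ideal.mem_colon_span_singleton, mem_ideal_span_monomial_image]
      intro x hx
      refine ⟨w, ⟨hw, hwk⟩, ?_⟩
      have : (X l : MvPolynomial σ K) * monomial (e i) 1 = monomial (e i + Finsupp.single l 1) 1 := by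
        rw [X, monomial_mul, mul_one, add_comm]
      rw [this, support_monomial, if_neg one_ne_zero, Finset.mem_singleton] at hx
      rwa [hx]

theorem aux_mem_span {K σ : Type*} [Field K] (G : Set (σ →₀ ℕ)) (v : σ →₀ ℕ) :
    (monomial v (1 : K)) ∈ Ideal.span ((fun e => monomial e (1 : K)) '' G) ↔ ∃ g ∈ G, g ≤ v := by
  classical
  rw [mem_ideal_span_monomial_image, support_monomial, if_neg one_ne_zero]
  simp

theorem aux_mingen {K σ : Type*} [Field K] (G : Set (σ →₀ ℕ)) (D : ℕ)
    (hD : ∀ g ∈ G, g.degree = D) (I : Ideal (MvPolynomial σ K))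
    (hI : I = Ideal.span ((fun e => monomial e (1 : K)) '' G)) :
    (fun e => monomial e (1 : K)) '' G =
      {f | (∃ v : σ →₀ ℕ, f = monomial v (1 : K)) ∧ f ∈ I ∧
        f ∉ Ideal.span (Set.range (X : σ → MvPolynomial σ K)) * I} := by
  have hm : Ideal.span (Set.range (X : σ → MvPolynomial σ K)) * I =
      Ideal.span ((fun e => monomial e (1 : K)) ''
        {e | ∃ l, ∃ g ∈ G, e = Finsupp.single l 1 + g}) := by
    rw [hI, Ideal.span_mul_span']
    congr 1
    ext f
    rw [Set.mem_mul]
    constructor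
    · rintro ⟨_, ⟨l, rfl⟩, _, ⟨g, hg, rfl⟩, rfl⟩
      exact ⟨_, ⟨l, g, hg, rfl⟩, by simp [X, monomial_mul]⟩
    · rintro ⟨_, ⟨l, g, hg, rfl⟩, rfl⟩
      exact ⟨_, ⟨l, rfl⟩, _, ⟨g, hg, rfl⟩, by simp [X, monomial_mul]⟩
  rw [hm]
  ext f
  constructor
  · rintro ⟨g, hg, rfl⟩
    refine ⟨⟨g, rfl⟩, ?_, ?_⟩
    · rw [hI, aux_mem_span]
      exact ⟨g, hg, le_rfl⟩
    · rw [aux_mem_span]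
      rintro ⟨_, ⟨l, g', hg', rfl⟩, hle⟩
      have := Finsupp.degree_mono hle
      rw [map_add, Finsupp.degree_single, hD _ hg, hD _ hg'] at this
      omega
  · rintro ⟨⟨v, rfl⟩, h1, h2⟩
    rw [hI, aux_mem_span] at h1
    rw [aux_mem_span] at h2
    obtain ⟨g, hg, hle⟩ := h1
    refine ⟨g, hg, ?_⟩
    have : g = v := by
      by_contra hne
      apply h2
      have : ∃ l, g l < v l := by
        by_contra! hc
        exact hne (le_antisymm hle hc)
      obtain ⟨l, hl⟩ := this
      refine ⟨_, ⟨l, g, hg, rfl⟩, ?_⟩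
      intro l'
      have := hle l'
      by_cases hll : l' = l
      · subst hll; simp; omega
      · simp [Finsupp.single_apply, Ne.symm hll]; omega
    rw [this]

theorem aux_eq_of_le {σ : Type*} {f g : σ →₀ ℕ} (h : f ≤ g) (hd : g.degree ≤ f.degree) : f = g := by
  obtain ⟨c, rfl⟩ := exists_add_of_le h
  rw [map_add] at hd
  have : c.degree = 0 := by omega
  rw [Finsupp.degree_eq_zero_iff] at this
  simp [this]

/-- exponent from x-part and z-part -/
noncomputable def auxE {σ τ : Type*} (x : σ →₀ ℕ) (z : τ →₀ ℕ) : (σ ⊕ τ) →₀ ℕ :=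
  Finsupp.mapDomain Sum.inl x + Finsupp.mapDomain Sum.inr z

theorem auxE_inl {σ τ : Type*} (x : σ →₀ ℕ) (z : τ →₀ ℕ) (i : σ) :
    auxE x z (Sum.inl i) = x i := by
  rw [auxE, Finsupp.add_apply, Finsupp.mapDomain_apply Sum.inl_injective,
    Finsupp.mapDomain_of_notMem_range, add_zero]
  simp

theorem auxE_inr {σ τ : Type*} (x : σ →₀ ℕ) (z : τ →₀ ℕ) (i : τ) :
    auxE x z (Sum.inr i) = z i := by
  rw [auxE, Finsupp.add_apply, Finsupp.mapDomain_apply Sum.inr_injective,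
    Finsupp.mapDomain_of_notMem_range, zero_add]
  simp

theorem auxE_add {σ τ : Type*} (x x' : σ →₀ ℕ) (z z' : τ →₀ ℕ) :
    auxE (x + x') (z + z') = auxE x z + auxE x' z' := by
  simp only [auxE, Finsupp.mapDomain_add]; abel

theorem auxE_degree {σ τ : Type*} (x : σ →₀ ℕ) (z : τ →₀ ℕ) :
    (auxE x z).degree = x.degree + z.degree := by
  rw [auxE, map_add, Finsupp.degree_mapDomain, Finsupp.degree_mapDomain]

noncomputable def auxX {σ τ : Type*} (e : (σ ⊕ τ) →₀ ℕ) : σ →₀ ℕ :=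
  Finsupp.comapDomain Sum.inl e Sum.inl_injective.injOn
noncomputable def auxZ {σ τ : Type*} (e : (σ ⊕ τ) →₀ ℕ) : τ →₀ ℕ :=
  Finsupp.comapDomain Sum.inr e Sum.inr_injective.injOn

theorem auxX_E {σ τ : Type*} (x : σ →₀ ℕ) (z : τ →₀ ℕ) : auxX (auxE x z) = x := by
  ext i; rw [auxX, Finsupp.comapDomain_apply, auxE_inl]
theorem auxZ_E {σ τ : Type*} (x : σ →₀ ℕ) (z : τ →₀ ℕ) : auxZ (auxE x z) = z := by
  ext i; rw [auxZ, Finsupp.comapDomain_apply, auxE_inr]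
theorem auxE_XZ {σ τ : Type*} (e : (σ ⊕ τ) →₀ ℕ) : auxE (auxX e) (auxZ e) = e := by
  ext i
  rcases i with i | i
  · rw [auxE_inl, auxX, Finsupp.comapDomain_apply]
  · rw [auxE_inr, auxZ, Finsupp.comapDomain_apply]

noncomputable def auxKey {m n : ℕ} (e : (Fin m ⊕ Fin n) →₀ ℕ) :
    ℕ ×ₗ ((Lex (Fin m →₀ ℕ))ᵒᵈ ×ₗ (Lex (Fin n →₀ ℕ))ᵒᵈ) :=
  toLex ((auxX e).degree, toLex (OrderDual.toDual (toLex (auxX e)),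
    OrderDual.toDual (toLex (auxZ e))))

theorem auxKey_inj {m n : ℕ} : Function.Injective (auxKey (m := m) (n := n)) := by
  intro e f h
  have h' := congrArg ofLex h
  simp only [auxKey, ofLex_toLex, Prod.mk.injEq] at h'
  have h2 := congrArg ofLex h'.2
  simp only [ofLex_toLex, Prod.mk.injEq] at h2
  rw [← auxE_XZ e, ← auxE_XZ f]
  have a1 : auxX e = auxX f := by simpa using h2.1
  have a2 : auxZ e = auxZ f := by simpa using h2.2
  rw [a1, a2]

theorem auxKey_lt {m n : ℕ} (x x' : Fin m →₀ ℕ) (z z' : Fin n →₀ ℕ) :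
    auxKey (auxE x z) < auxKey (auxE x' z') ↔ x.degree < x'.degree ∨
      (x.degree = x'.degree ∧ (toLex x' < toLex x ∨ (x = x' ∧ toLex z' < toLex z))) := by
  simp [auxKey, auxX_E, auxZ_E, Prod.Lex.lt_iff]

theorem aux_le_deg {σ : Type*} {f g : σ →₀ ℕ} (h : f.degree ≤ g.degree) (hne : f ≠ g) :
    ∃ l, f l < g l := by
  by_contra! hc
  exact hne (aux_eq_of_le (f := g) (g := f) hc h).symm

/-- generator exponents of the a-th power -/
def auxG (m n k d : ℕ) (μ : Fin k → (Fin n →₀ ℕ)) (φ : Fin k → Fin m) (a : ℕ) :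
    Set ((Fin m ⊕ Fin n) →₀ ℕ) :=
  {e | ∃ (r : ℕ) (M : Fin n →₀ ℕ) (A : Fin k →₀ ℕ), r + A.degree = a ∧
    M.degree = r * (d + 1) ∧
    e = auxE (Finsupp.mapDomain φ A) (M + Finsupp.linearCombination ℕ μ A)}

theorem aux_lc_deg {n k d : ℕ} (μ : Fin k → (Fin n →₀ ℕ)) (hdeg : ∀ i, (μ i).degree = d)
    (A : Fin k →₀ ℕ) : (Finsupp.linearCombination ℕ μ A).degree = A.degree * d := by
  induction A using Finsupp.induction_linear with
  | zero => simp
  | add f g hf hg => rw [map_add, map_add, hf, hg, map_add, add_mul]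
  | single i c => simp [Finsupp.linearCombination_single, hdeg]

theorem auxG_deg {m n k d : ℕ} (μ : Fin k → (Fin n →₀ ℕ)) (φ : Fin k → Fin m)
    (hdeg : ∀ i, (μ i).degree = d) (a : ℕ) :
    ∀ g ∈ auxG m n k d μ φ a, g.degree = a * (d + 1) := by
  rintro _ ⟨r, M, A, h1, h2, rfl⟩
  rw [auxE_degree, map_add, aux_lc_deg μ hdeg, Finsupp.degree_mapDomain, h2, ← h1]
  ring

theorem aux_split {k : ℕ} {A : Fin k →₀ ℕ} {i : Fin k} (h : 1 ≤ A i) :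
    ∃ A', A = A' + Finsupp.single i 1 := by
  obtain ⟨c, hc⟩ := exists_add_of_le (a := Finsupp.single i 1) (b := A) (by simpa using h)
  exact ⟨c, by rw [hc, add_comm]⟩

theorem aux_split' {k : ℕ} {A : Fin k →₀ ℕ} (h : A ≠ 0) :
    ∃ i A', A = A' + Finsupp.single i 1 := by
  obtain ⟨i, hi⟩ := Finsupp.ne_iff.1 h
  exact ⟨i, aux_split (Nat.one_le_iff_ne_zero.2 hi)⟩

theorem auxG_span (K : Type*) [Field K] {m n k d : ℕ} (μ : Fin k → (Fin n →₀ ℕ))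
    (φ : Fin k → Fin m)
    (J : Ideal (MvPolynomial (Fin m ⊕ Fin n) K))
    (hJ : J = Ideal.span
      ({w | ∃ v : Fin n →₀ ℕ, (v.sum fun _ e => e) = d + 1 ∧
          w = monomial (Finsupp.mapDomain Sum.inr v) 1} ∪
        {w | ∃ i : Fin k,
          w = X (Sum.inl (φ i)) * monomial (Finsupp.mapDomain Sum.inr (μ i)) 1})) (a : ℕ) :
    J ^ a = Ideal.span ((fun e => monomial e (1 : K)) '' auxG m n k d μ φ a) := by
  have hg1 : ∀ v : Fin n →₀ ℕ, (monomial (Finsupp.mapDomain Sum.inr v) 1 :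
      MvPolynomial (Fin m ⊕ Fin n) K) = monomial (auxE 0 v) 1 := by
    intro v; simp [auxE]
  have hg2 : ∀ i : Fin k, (X (Sum.inl (φ i)) * monomial (Finsupp.mapDomain Sum.inr (μ i)) 1 :
      MvPolynomial (Fin m ⊕ Fin n) K) = monomial (auxE (Finsupp.single (φ i) 1) (μ i)) 1 := by
    intro i; simp [auxE, X, monomial_mul, Finsupp.mapDomain_single]
  induction a with
  | zero =>
    rw [pow_zero, Ideal.one_eq_top, eq_comm, Ideal.eq_top_iff_one]
    apply Ideal.subset_span
    refine ⟨0, ⟨0, 0, 0, by simp, by simp, by simp [auxE]⟩, by simp⟩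
  | succ a ih =>
    rw [pow_succ, ih]
    conv_lhs => rw [hJ]
    rw [Ideal.span_mul_span']
    congr 1
    ext f
    rw [Set.mem_mul]
    constructor
    · rintro ⟨_, ⟨_, ⟨r, M, A, h1, h2, rfl⟩, rfl⟩, _, ⟨v, hv, rfl⟩ | ⟨i, rfl⟩, rfl⟩
      · replace hv : v.degree = d + 1 := hv
        refine ⟨_, ⟨r + 1, M + v, A, by omega, by rw [map_add, h2, hv]; ring, rfl⟩, ?_⟩
        simp only [hg1, monomial_mul, mul_one, ← auxE_add]
        refine congrArg (fun e => monomial e (1 : K)) (congrArg₂ auxE ?_ ?_)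
        · simp
        · abel
      · refine ⟨_, ⟨r, M, A + Finsupp.single i 1, by
          rw [map_add, Finsupp.degree_single]; omega, h2, rfl⟩, ?_⟩
        simp only [hg2, monomial_mul, mul_one, ← auxE_add]
        refine congrArg (fun e => monomial e (1 : K)) (congrArg₂ auxE ?_ ?_)
        · simp [Finsupp.mapDomain_add, Finsupp.mapDomain_single]
        · simp [Finsupp.linearCombination_single]; abel
    · rintro ⟨_, ⟨r, M, A, h1, h2, rfl⟩, rfl⟩
      by_cases hA : A = 0
      · subst hA
        simp only [map_zero, add_zero] at h1
        subst h1
        obtain ⟨v, hvM, hv⟩ := Finsupp.exists_le_degree_eq M (d + 1) (by rw [h2]; nlinarith)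
        obtain ⟨M', rfl⟩ := exists_add_of_le hvM
        refine ⟨_, ⟨_, ⟨a, M', 0, by simp, ?_, rfl⟩, rfl⟩, _, Or.inl ⟨v, hv, rfl⟩, ?_⟩
        · rw [map_add, hv] at h2
          nlinarith
        · simp only [hg1, monomial_mul, mul_one, ← auxE_add]
          refine congrArg (fun e => monomial e (1 : K)) (congrArg₂ auxE ?_ ?_)
          · simp
          · simp; abel
      · obtain ⟨i, A', rfl⟩ := aux_split' hA
        rw [map_add, Finsupp.degree_single] at h1
        refine ⟨_, ⟨_, ⟨r, M, A', by omega, h2, rfl⟩, rfl⟩, _, Or.inr ⟨i, rfl⟩, ?_⟩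
        simp only [hg2, monomial_mul, mul_one, ← auxE_add]
        refine congrArg (fun e => monomial e (1 : K)) (congrArg₂ auxE ?_ ?_)
        · simp [Finsupp.mapDomain_add, Finsupp.mapDomain_single]
        · simp [Finsupp.linearCombination_single]; abel

theorem aux_phi (K : Type*) [Field K] {n k : ℕ} (μ : Fin k → (Fin n →₀ ℕ))
    (M : Fin n →₀ ℕ) (A : Fin k →₀ ℕ) :
    (aeval (Sum.elim
    (fun i : Fin n => (X (Sum.inl i) : MvPolynomial (Fin n ⊕ Unit) K))
    (fun i : Fin k => monomial (Finsupp.mapDomain Sum.inl (μ i)) 1 * X (Sum.inr ()))) :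
    MvPolynomial (Fin n ⊕ Fin k) K →ₐ[K] MvPolynomial (Fin n ⊕ Unit) K)
    (monomial (Finsupp.mapDomain Sum.inl M + Finsupp.mapDomain Sum.inr A) (1 : K)) =
    monomial (auxE (M + Finsupp.linearCombination ℕ μ A) (Finsupp.single () A.degree)) 1 := by
  set F := (aeval (Sum.elim
    (fun i : Fin n => (X (Sum.inl i) : MvPolynomial (Fin n ⊕ Unit) K))
    (fun i : Fin k => monomial (Finsupp.mapDomain Sum.inl (μ i)) 1 * X (Sum.inr ()))) :
    MvPolynomial (Fin n ⊕ Fin k) K →ₐ[K] MvPolynomial (Fin n ⊕ Unit) K) with hF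
  have h1 : F (monomial (Finsupp.mapDomain Sum.inl M) (1 : K)) = monomial (auxE M 0) 1 := by
    induction M using Finsupp.induction_linear with
    | zero => simp [auxE]
    | add f g hf hg =>
      have : (monomial (Finsupp.mapDomain Sum.inl (f + g)) (1 : K) :
          MvPolynomial (Fin n ⊕ Fin k) K) = monomial (Finsupp.mapDomain Sum.inl f) (1 : K) *
          monomial (Finsupp.mapDomain Sum.inl g) (1 : K) := by
        rw [monomial_mul, mul_one, Finsupp.mapDomain_add]
      rw [this, map_mul, hf, hg, monomial_mul, ← auxE_add]
      simp
    | single i c =>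
      rw [Finsupp.mapDomain_single, ← X_pow_eq_monomial, map_pow]
      simp [hF, auxE, Finsupp.mapDomain_single, X_pow_eq_monomial]
  have h2 : F (monomial (Finsupp.mapDomain Sum.inr A) (1 : K)) =
      monomial (auxE (Finsupp.linearCombination ℕ μ A) (Finsupp.single () A.degree)) 1 := by
    induction A using Finsupp.induction_linear with
    | zero => simp [auxE]
    | add f g hf hg =>
      have : (monomial (Finsupp.mapDomain Sum.inr (f + g)) (1 : K) :
          MvPolynomial (Fin n ⊕ Fin k) K) = monomial (Finsupp.mapDomain Sum.inr f) (1 : K) *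
          monomial (Finsupp.mapDomain Sum.inr g) (1 : K) := by
        rw [monomial_mul, mul_one, Finsupp.mapDomain_add]
      rw [this, map_mul, hf, hg, monomial_mul, ← auxE_add]
      simp
    | single i c =>
      rw [Finsupp.mapDomain_single, ← X_pow_eq_monomial, map_pow]
      have : F (X (Sum.inr i)) = monomial (auxE (μ i) (Finsupp.single () 1)) 1 := by
        rw [hF, aeval_X, Sum.elim_inr, auxE, Finsupp.mapDomain_single, X, monomial_mul, mul_one]
      rw [this, monomial_pow, one_pow, Finsupp.linearCombination_single, Finsupp.degree_single]
      refine congrArg (fun e => monomial e (1 : K)) ?_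
      ext j
      rcases j with j | j
      · simp [auxE_inl]
      · simp [auxE_inr]
  have h3 : (monomial (Finsupp.mapDomain Sum.inl M + Finsupp.mapDomain Sum.inr A) (1 : K) :
      MvPolynomial (Fin n ⊕ Fin k) K) = monomial (Finsupp.mapDomain Sum.inl M) 1 *
        monomial (Finsupp.mapDomain Sum.inr A) 1 := by
    rw [monomial_mul, mul_one]
  rw [h3, map_mul, h1, h2, monomial_mul, ← auxE_add]
  simp

theorem aux_ker (K : Type*) [Field K] {n k : ℕ} (μ : Fin k → (Fin n →₀ ℕ))
    (M N : Fin n →₀ ℕ) (A B : Fin k →₀ ℕ) :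
    (monomial (Finsupp.mapDomain Sum.inl M + Finsupp.mapDomain Sum.inr A) (1 : K) -
        monomial (Finsupp.mapDomain Sum.inl N + Finsupp.mapDomain Sum.inr B) 1) ∈
        reesKer K n k μ ↔ (M + Finsupp.linearCombination ℕ μ A =
          N + Finsupp.linearCombination ℕ μ B ∧ A.degree = B.degree) := by
  rw [reesKer, RingHom.mem_ker, map_sub, sub_eq_zero]
  have h1 := aux_phi K μ M A
  have h2 := aux_phi K μ N B
  refine Iff.trans (Eq.congr h1 h2) ?_
  constructor
  · intro h
    have h := monomial_left_injective (one_ne_zero) h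
    refine ⟨?_, ?_⟩
    · have := congrArg auxX h
      rwa [auxX_E, auxX_E] at this
    · have := congrArg auxZ h
      rw [auxZ_E, auxZ_E] at this
      simpa using this
  · rintro ⟨h, h'⟩
    rw [h, h']

theorem aux_exch (K : Type*) [Field K] {m n k d p : ℕ}
    (μ : Fin k → (Fin n →₀ ℕ)) (φ : Fin k → Fin m)
    (hdeg : ∀ i : Fin k, (μ i).degree = d)
    (hpl : IsPseudoLinear K m n k d p μ φ) (a : ℕ) (hap : a ≤ p) :
    ∀ u ∈ auxG m n k d μ φ a, ∀ v ∈ auxG m n k d μ φ a, auxKey v < auxKey u →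
      ∃ w ∈ auxG m n k d μ φ a, auxKey w < auxKey u ∧
      ∃ l, u l < v l ∧ w ≤ u + Finsupp.single l 1 := by
  intro u hu v hv hlt
  have hdu := auxG_deg μ φ hdeg a u hu
  have hdv := auxG_deg μ φ hdeg a v hv
  obtain ⟨r, N, B, hr, hN, rfl⟩ := hu
  obtain ⟨r', M, A, hr', hM, rfl⟩ := hv
  rw [auxKey_lt] at hlt
  rw [auxE_degree] at hdu hdv
  simp only [Finsupp.degree_mapDomain] at hlt hdu hdv
  by_cases hB : B = 0
  · subst hB
    simp only [map_zero, Finsupp.mapDomain_zero, add_zero, zero_add] at *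
    rcases hlt with h | ⟨h, h'⟩
    · omega
    have hA : A = 0 := (Finsupp.degree_eq_zero_iff A).1 h
    subst hA
    simp only [map_zero, Finsupp.mapDomain_zero, add_zero, zero_add] at *
    rcases h' with h' | ⟨-, h'⟩
    · exact absurd h' (lt_irrefl _)
    obtain ⟨l, hl1, hl2⟩ := Finsupp.Lex.lt_iff.1 h'
    simp only [ofLex_toLex] at hl1 hl2
    obtain ⟨l', hl'⟩ := aux_le_deg (f := M) (g := N) (by omega) (by
      rintro rfl; exact lt_irrefl _ h')
    have hll : l < l' := by
      rcases lt_trichotomy l l' with h | h | h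
      · exact h
      · subst h; omega
      · have := hl1 l' h; omega
    obtain ⟨N', rfl⟩ := aux_split (A := N) (i := l') (by omega)
    refine ⟨auxE 0 (N' + Finsupp.single l 1), ⟨r, N' + Finsupp.single l 1, 0, by simpa using hr,
      ?_, by simp⟩, ?_, Sum.inr l, ?_, ?_⟩
    · rw [← hN]; simp
    · rw [auxKey_lt]
      refine Or.inr ⟨rfl, Or.inr ⟨rfl, ?_⟩⟩
      rw [toLex_add, toLex_add]
      exact add_lt_add_right (Finsupp.Lex.single_lt_iff.2 hll) _
    · rw [auxE_inr, auxE_inr]; exact hl2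
    · intro i
      rcases i with i | i
      · simp [auxE_inl]
      · simp only [Finsupp.add_apply, auxE_inr, Finsupp.single_apply, Sum.inr.injEq]
        omega
  · by_cases hl : ∃ l, (N + Finsupp.linearCombination ℕ μ B) l <
        (M + Finsupp.linearCombination ℕ μ A) l
    · obtain ⟨l, hl⟩ := hl
      obtain ⟨j, B', rfl⟩ := aux_split' hB
      rw [map_add, Finsupp.degree_single] at hr
      refine ⟨_, ⟨r + 1, N + μ j + Finsupp.single l 1, B', by omega, ?_, rfl⟩, ?_,
        Sum.inr l, ?_, ?_⟩
      · rw [map_add, map_add, hN, hdeg, Finsupp.degree_single]; ring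
      · rw [auxKey_lt]
        left
        simp [Finsupp.degree_mapDomain]
      · rw [auxE_inr, auxE_inr]; exact hl
      · intro i
        rcases i with i | i
        · simp [auxE_inl, Finsupp.mapDomain_add]
        · simp [auxE_inr, Finsupp.single_apply, Sum.inr.injEq]
          omega
    · push Not at hl
      have hAB : A.degree ≤ B.degree := by omega
      have hz := aux_eq_of_le (f := M + Finsupp.linearCombination ℕ μ A)
        (g := N + Finsupp.linearCombination ℕ μ B) hl (by omega)
      rw [hz] at hlt hdv
      have hd : A.degree = B.degree := by omega
      have hx : toLex (Finsupp.mapDomain φ B) < toLex (Finsupp.mapDomain φ A) := by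
        rcases hlt with h | ⟨_, h | ⟨_, h⟩⟩
        · omega
        · exact h
        · exact absurd h (lt_irrefl _)
      have hB1 : 1 ≤ B.degree := by
        rw [Nat.one_le_iff_ne_zero]
        intro h
        exact hB ((Finsupp.degree_eq_zero_iff B).1 h)
      have hr1 : r = a - B.degree := by omega
      have hr2 : r' = a - B.degree := by omega
      obtain ⟨i, j, M₁, N₁, hk, hNN, hAi, hBj, hphi, hij⟩ := hpl a B.degree hB1 (by omega) hap M N A B
        (by rw [← hr2]; exact hM) (by rw [← hr1]; exact hN) hd rfl hx
        ((aux_ker K μ M N A B).2 ⟨hz, hd⟩)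
      have hk1 := ((aux_ker K μ _ _ _ _).1 hk).1
      simp only [Finsupp.linearCombination_single, one_smul] at hk1
      obtain ⟨N', rfl⟩ := exists_add_of_le hNN
      obtain ⟨B', rfl⟩ := aux_split hBj
      have hMN : M₁.degree = N₁.degree := by
        have := congrArg Finsupp.degree hk1
        rw [map_add, map_add, hdeg, hdeg] at this
        omega
      have hzz : M₁ + N' + Finsupp.linearCombination ℕ μ (B' + Finsupp.single i 1) =
          N₁ + N' + Finsupp.linearCombination ℕ μ (B' + Finsupp.single j 1) := by
        simp only [map_add, Finsupp.linearCombination_single, one_smul]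
        calc _ = (M₁ + μ i) + (N' + Finsupp.linearCombination ℕ μ B') := by abel
          _ = _ := by rw [hk1]; abel
      refine ⟨_, ⟨r, M₁ + N', B' + Finsupp.single i 1, ?_, ?_, rfl⟩, ?_, Sum.inl (φ i), ?_, ?_⟩
      · rw [← hr]; simp
      · rw [← hN]; simp [hMN]
      · rw [auxKey_lt]
        refine Or.inr ⟨by simp [Finsupp.degree_mapDomain], Or.inl ?_⟩
        rw [Finsupp.mapDomain_add, Finsupp.mapDomain_add, Finsupp.mapDomain_single,
          Finsupp.mapDomain_single, toLex_add, toLex_add]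
        exact add_lt_add_right hij _
      · rw [auxE_inl, auxE_inl]; exact hphi
      · rw [hzz]
        intro q
        rcases q with q | q
        · simp only [Finsupp.add_apply, auxE_inl, Finsupp.mapDomain_add, Finsupp.mapDomain_single,
            Finsupp.single_apply, Sum.inl.injEq]
          omega
        · simp only [Finsupp.add_apply, auxE_inr]
          omega

/-- If the monomials `m₁, …, m_k` of degree `d` in `z₁, …, z_n` are
pseudo-linear of order `p` with respect to `φ`, then for every `1 ≤ a ≤ p` the power
`J^a` of the ideal `J = (z₁,…,z_n)^{d+1} + (φ(t₁)m₁, …, φ(t_k)m_k)` of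
`K[x₁,…,x_m,z₁,…,z_n]` (here `MvPolynomial (Fin m ⊕ Fin n) K`, with `x_j = X (inl j)`
and `z_i = X (inr i)`) has linear quotients: there is an ordering `u₁, …, u_s` of the
minimal monomial generators of `J^a` (the monic monomials lying in `J^a` but not in
`𝔪·J^a`, `𝔪` being the ideal of all the variables) such that each colon ideal
`(u₁,…,u_{i-1}) : (u_i)` is generated by a subset of the variables. -/
theorem stmt3 (K : Type*) [Field K] (m n k d p : ℕ)
    (μ : Fin k → (Fin n →₀ ℕ)) (φ : Fin k → Fin m)
    (hdeg : ∀ i : Fin k, ((μ i).sum fun _ e => e) = d)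
    (hpl : IsPseudoLinear K m n k d p μ φ)
    (J : Ideal (MvPolynomial (Fin m ⊕ Fin n) K))
    (hJ : J = Ideal.span
      ({w | ∃ v : Fin n →₀ ℕ, (v.sum fun _ e => e) = d + 1 ∧
          w = monomial (Finsupp.mapDomain Sum.inr v) 1} ∪
        {w | ∃ i : Fin k,
          w = X (Sum.inl (φ i)) * monomial (Finsupp.mapDomain Sum.inr (μ i)) 1})) :
    ∀ a : ℕ, 1 ≤ a → a ≤ p →
      ∃ (s : ℕ) (u : Fin s → MvPolynomial (Fin m ⊕ Fin n) K),
        Function.Injective u ∧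
        Set.range u =
          {f | (∃ v : (Fin m ⊕ Fin n) →₀ ℕ, f = monomial v (1 : K)) ∧ f ∈ J ^ a ∧
            f ∉ Ideal.span
              (Set.range (X : (Fin m ⊕ Fin n) → MvPolynomial (Fin m ⊕ Fin n) K)) *
              J ^ a} ∧
        ∀ i : Fin s,
          ∃ S ⊆ Set.range (X : (Fin m ⊕ Fin n) → MvPolynomial (Fin m ⊕ Fin n) K),
            Submodule.colon (Ideal.span {g | ∃ j : Fin s, j < i ∧ g = u j})
              (Ideal.span {u i}) = Ideal.span S := by
  intro a _ hap
  have hdeg' : ∀ i : Fin k, (μ i).degree = d := hdeg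
  have hG := auxG_deg μ φ hdeg' a
  obtain ⟨s, u, h1, h2, h3⟩ := aux_linquot (K := K) (auxG m n k d μ φ a)
    ((Finsupp.finite_of_degree_eq (a * (d + 1))).subset hG) auxKey auxKey_inj
    (aux_exch K μ φ hdeg' hpl a hap)
  refine ⟨s, u, h1, ?_, h3⟩
  rw [h2]
  exact aux_mingen _ _ hG _ (auxG_span K μ φ J hJ a)
end

section
/- For every field K and every integer d > 1, the monomials m₁ = z₁^d, m₂ = z₂^d, m₃ = z₁^{d−1}z₂ in K[z₁, z₂] are pseudo-linear of order d−1 with respect to the map φ : {t₁, t₂, t₃} → {x₁, x₂} defined by φ(t₁) = x₁, φ(t₂) = x₁, φ(t₃) = x₂. -/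
open MvPolynomial

lemma rees_eval (K : Type*) [Field K] (n k : ℕ) (μ : Fin k → (Fin n →₀ ℕ))
    (M : Fin n →₀ ℕ) (A : Fin k →₀ ℕ) :
    (aeval (Sum.elim
    (fun i : Fin n => (X (Sum.inl i) : MvPolynomial (Fin n ⊕ Unit) K))
    (fun i : Fin k => monomial (Finsupp.mapDomain Sum.inl (μ i)) 1 * X (Sum.inr ()))))
      (monomial (Finsupp.mapDomain Sum.inl M + Finsupp.mapDomain Sum.inr A) (1 : K))
    = monomial (Finsupp.mapDomain Sum.inl (M + ∑ i, A i • μ i)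
        + Finsupp.single (Sum.inr ()) (∑ i, A i)) (1 : K) := by
  rw [aeval_monomial, Finsupp.prod_add_index' (by simp) (by intros; rw [pow_add]),
    Finsupp.prod_mapDomain_index_inj Sum.inl_injective,
    Finsupp.prod_mapDomain_index_inj Sum.inr_injective]
  have h1 : (M.prod fun i e => (X (Sum.inl i) : MvPolynomial (Fin n ⊕ Unit) K) ^ e)
      = monomial (Finsupp.mapDomain Sum.inl M) 1 := by
    rw [monomial_eq, Finsupp.prod_mapDomain_index_inj Sum.inl_injective]
    simp
  have h2 : (A.prod fun i e => ((monomial (Finsupp.mapDomain Sum.inl (μ i)) 1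
      * X (Sum.inr ()) : MvPolynomial (Fin n ⊕ Unit) K)) ^ e)
      = monomial (Finsupp.mapDomain Sum.inl (∑ i, A i • μ i)
        + Finsupp.single (Sum.inr ()) (∑ i, A i)) 1 := by
    rw [Finsupp.prod_fintype _ _ (by simp)]
    have : ∀ i, ((monomial (Finsupp.mapDomain Sum.inl (μ i)) 1
      * X (Sum.inr ()) : MvPolynomial (Fin n ⊕ Unit) K)) ^ (A i)
      = monomial (A i • (Finsupp.mapDomain Sum.inl (μ i) + Finsupp.single (Sum.inr ()) 1)) 1 := by
      intro i
      rw [X, monomial_mul, monomial_pow]; simp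
    simp only [this]
    rw [← monomial_sum_one]
    simp only [smul_add, Finset.sum_add_distrib]
    have q1 : Finsupp.mapDomain (Sum.inl : Fin n → Fin n ⊕ Unit) (∑ i, A i • μ i)
        = ∑ i, A i • Finsupp.mapDomain Sum.inl (μ i) := by
      rw [← Finsupp.mapDomain.addMonoidHom_apply, map_sum]
      simp [Finsupp.mapDomain_smul]
    have q2 : (Finsupp.single (Sum.inr ()) (∑ i, A i) : (Fin n ⊕ Unit) →₀ ℕ)
        = ∑ i, A i • Finsupp.single (Sum.inr ()) 1 := by
      rw [← Finsupp.singleAddHom_apply, map_sum]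
      simp
    rw [q1, q2]
  simp only [Sum.elim_inl, Sum.elim_inr, h1, h2, map_one, one_mul, monomial_mul, mul_one]
  rw [Finsupp.mapDomain_add, add_assoc]

lemma rees_mem (K : Type*) [Field K] (n k : ℕ) (μ : Fin k → (Fin n →₀ ℕ))
    (M N : Fin n →₀ ℕ) (A B : Fin k →₀ ℕ) (h : ∑ i, A i = ∑ i, B i) :
    (monomial (Finsupp.mapDomain Sum.inl M + Finsupp.mapDomain Sum.inr A) (1 : K) -
        monomial (Finsupp.mapDomain Sum.inl N + Finsupp.mapDomain Sum.inr B) 1) ∈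
        reesKer K n k μ ↔ M + ∑ i, A i • μ i = N + ∑ i, B i • μ i := by
  rw [reesKer, RingHom.mem_ker, map_sub, sub_eq_zero, rees_eval, rees_eval, h]
  rw [(monomial_left_injective (one_ne_zero (α := K))).eq_iff, add_left_inj,
    (Finsupp.mapDomain_injective Sum.inl_injective).eq_iff]

lemma lex2 (a b : Fin 2 →₀ ℕ) : toLex a < toLex b ↔ a 0 < b 0 ∨ (a 0 = b 0 ∧ a 1 < b 1) := by
  rw [Finsupp.Lex.lt_iff]
  constructor
  · rintro ⟨i, h1, h2⟩
    fin_cases i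
    · left; exact h2
    · right; exact ⟨h1 0 (by decide), h2⟩
  · rintro (h | ⟨h, h'⟩)
    · exact ⟨0, fun j hj => absurd hj (by simp), h⟩
    · refine ⟨1, fun j hj => ?_, h'⟩
      have : j = 0 := by omega
      subst this; exact h

lemma mapDom (A : Fin 3 →₀ ℕ) : Finsupp.mapDomain (![0, 0, 1] : Fin 3 → Fin 2) A 0 = A 0 + A 1
    ∧ Finsupp.mapDomain (![0, 0, 1] : Fin 3 → Fin 2) A 1 = A 2 := by
  constructor <;>
  · rw [Finsupp.mapDomain, Finsupp.sum_fintype _ _ (by simp)]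
    simp [Fin.sum_univ_three]

/-- For every field `K` and every `d > 1`, the monomials
`m₁ = z₁^d`, `m₂ = z₂^d`, `m₃ = z₁^{d-1}z₂` in `K[z₁,z₂]` (given by their exponent
vectors) are pseudo-linear of order `d - 1` with respect to the map
`φ : {t₁,t₂,t₃} → {x₁,x₂}` with `φ(t₁) = x₁`, `φ(t₂) = x₁`, `φ(t₃) = x₂`. -/
theorem stmt4 (K : Type*) [Field K] (d : ℕ) (hd : 1 < d) :
    IsPseudoLinear K 2 2 3 d (d - 1)
      ![Finsupp.single 0 d, Finsupp.single 1 d,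
        Finsupp.single 0 (d - 1) + Finsupp.single 1 1]
      ![0, 0, 1] := by
  intro a b hb hba had M N A B hM hN hA hB hlt hmem
  obtain ⟨e, rfl⟩ : ∃ e, d = e + 2 := ⟨d - 2, by omega⟩
  obtain ⟨c, rfl⟩ : ∃ c, a = b + c := ⟨a - b, by omega⟩
  rw [Finsupp.sum_fintype _ _ (by simp)] at hM hN hA hB
  rw [rees_mem _ _ _ _ _ _ _ _ (hA.trans hB.symm)] at hmem
  have e0 := DFunLike.congr_fun hmem 0
  have e1 := DFunLike.congr_fun hmem 1
  rw [lex2, (mapDom A).1, (mapDom A).2, (mapDom B).1, (mapDom B).2] at hlt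
  simp [Fin.sum_univ_three, Fin.sum_univ_two] at hM hN hA hB e0 e1
  clear hmem
  have hAB : A 2 < B 2 := by omega
  obtain ⟨r, hr⟩ : ∃ r, B 2 = A 2 + r + 1 := ⟨B 2 - A 2 - 1, by omega⟩
  rw [hr] at e0 e1
  by_cases h0 : 1 ≤ A 0 ∧ 1 ≤ N 0
  · refine ⟨0, 2, Finsupp.single 1 1, Finsupp.single 0 1, ?_, ?_, h0.1, by omega, ?_, ?_⟩
    · rw [rees_mem _ _ _ _ _ _ _ _ (by simp)]
      ext i
      fin_cases i <;> simp [Fin.sum_univ_three] <;> omega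
    · rw [Finsupp.single_le_iff]; exact h0.2
    · have h1 := (mapDom A).1
      have h2 := (mapDom B).1
      simp only [Matrix.cons_val_zero]
      omega
    · rw [lex2]; simp
  by_cases h1 : 1 ≤ A 1 ∧ e + 1 ≤ N 1
  · refine ⟨1, 2, Finsupp.single 0 (e+1), Finsupp.single 1 (e+1), ?_, ?_, h1.1, by omega, ?_, ?_⟩
    · rw [rees_mem _ _ _ _ _ _ _ _ (by simp)]
      ext i
      fin_cases i <;> simp [Fin.sum_univ_three]
    · rw [Finsupp.single_le_iff]; exact h1.2
    · have h1 := (mapDom A).1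
      have h2 := (mapDom B).1
      simp only [Matrix.cons_val_one, Matrix.cons_val_zero]
      omega
    · rw [lex2]; simp
  exfalso
  rcases Nat.eq_zero_or_pos c with rfl | hc
  · have hM1 : M 1 = 0 := by omega
    have hN1 : N 1 = 0 := by omega
    rw [hM1, hN1] at e1
    have hr2 : r + 1 < e + 2 := by omega
    rcases le_or_gt (A 1) (B 1) with hh | hh
    · nlinarith
    · nlinarith
  · have hc' : 1 * (e + 2 + 1) ≤ c * (e+2+1) := Nat.mul_le_mul_right _ hc
    have hN' : 1 ≤ N 0 ∨ e + 1 ≤ N 1 := by omega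
    have hr0 : 0 ≤ r * (e + 1) := Nat.zero_le _
    have h3 : 0 ≤ B 0 * (e+2) := Nat.zero_le _
    have h4 : 0 ≤ B 1 * (e+2) := Nat.zero_le _
    by_cases hA0 : A 0 = 0
    · have hN1 : N 1 ≤ e := by omega
      rw [hA0] at e0
      nlinarith
    · have hN0 : N 0 = 0 := by omega
      have hA1 : A 1 = 0 := by omega
      rw [hA1] at e1
      nlinarith
end

section
/- Let d > 1 and let a, b be integers with 1 ≤ b ≤ a ≤ d−1. Let α₁, α₂, α₃, β₁, β₂, β₃, v₁, v₂, u₁, u₂ be nonnegative integers satisfying: α₁+α₂+α₃ = β₁+β₂+β₃ = b; v₁+v₂ = u₁+u₂ = (a−b)(d+1); v₁ + dα₁ + (d−1)α₃ = u₁ + dβ₁ + (d−1)β₃; v₂ + dα₂ + α₃ = u₂ + dβ₂ + β₃; and α₁+α₂ > β₁+β₂. Then either (α₁ > 0 and β₃ > 0 and u₁ > 0) or (α₂ > 0 and β₃ > 0 and u₂ ≥ d−1). -/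
/-- Let `d > 1` and `1 ≤ b ≤ a ≤ d - 1`. Given nonnegative integers
`α₁, α₂, α₃, β₁, β₂, β₃, v₁, v₂, u₁, u₂` satisfying the listed linear relations
(coming from a binomial `MA - NB` in the kernel of the Rees presentation of
`(z₁^d, z₂^d, z₁^{d-1}z₂)` with `φ(A) > φ(B)` lexicographically), either
`α₁ > 0 ∧ β₃ > 0 ∧ u₁ > 0` or `α₂ > 0 ∧ β₃ > 0 ∧ u₂ ≥ d - 1`. -/
theorem stmt6 (d a b : ℕ) (hd : 1 < d) (hb : 1 ≤ b) (hba : b ≤ a) (had : a ≤ d - 1)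
    (α₁ α₂ α₃ β₁ β₂ β₃ v₁ v₂ u₁ u₂ : ℕ)
    (hα : α₁ + α₂ + α₃ = b) (hβ : β₁ + β₂ + β₃ = b)
    (hv : v₁ + v₂ = (a - b) * (d + 1)) (hu : u₁ + u₂ = (a - b) * (d + 1))
    (h1 : v₁ + d * α₁ + (d - 1) * α₃ = u₁ + d * β₁ + (d - 1) * β₃)
    (h2 : v₂ + d * α₂ + α₃ = u₂ + d * β₂ + β₃)
    (h3 : β₁ + β₂ < α₁ + α₂) :
    (0 < α₁ ∧ 0 < β₃ ∧ 0 < u₁) ∨ (0 < α₂ ∧ 0 < β₃ ∧ d - 1 ≤ u₂) := by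
  obtain ⟨e, rfl⟩ : ∃ e, d = e + 1 := ⟨d - 1, by omega⟩
  obtain ⟨k, rfl⟩ : ∃ k, β₃ = α₃ + k + 1 := ⟨β₃ - α₃ - 1, by omega⟩
  obtain ⟨m, rfl⟩ : ∃ m, a = b + m := ⟨a - b, by omega⟩
  simp only [Nat.add_sub_cancel, Nat.add_sub_cancel_left] at *
  rcases Nat.eq_zero_or_pos α₁ with h | h
  · right
    have e2 : α₂ = β₁ + β₂ + k + 1 := by omega
    subst e2
    refine ⟨by omega, by omega, ?_⟩
    have : 0 ≤ e * β₁ := Nat.zero_le _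
    have : 0 ≤ e * k := Nat.zero_le _
    nlinarith
  · rcases Nat.eq_zero_or_pos u₁ with hu1 | hu1
    · right
      rcases Nat.eq_zero_or_pos α₂ with h' | h'
      · exfalso
        have e1 : α₁ = β₁ + β₂ + k + 1 := by omega
        subst e1
        subst hu1
        have : 0 ≤ e * β₂ := Nat.zero_le _
        nlinarith
      · refine ⟨h', by omega, ?_⟩
        rcases Nat.eq_zero_or_pos m with hm | hm
        · exfalso
          subst hm
          have hv2 : v₂ = 0 := by omega
          have hu2 : u₂ = 0 := by omega
          subst hv2 hu2
          rcases Nat.lt_or_ge β₂ α₂ with hl | hl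
          · obtain ⟨x, rfl⟩ := Nat.exists_eq_add_of_lt hl
            have : 0 ≤ e * x := Nat.zero_le _
            nlinarith
          · have := Nat.mul_le_mul_left (e + 1) hl
            omega
        · nlinarith
    · left
      exact ⟨h, by omega, hu1⟩
end

section
/- Let K be a field. The ideal I = (a², ab, ac, ad, b², ae + bd, d²) of the polynomial ring K[a,b,c,d,e] has linear quotients with respect to its generators in the given order: setting f₁ = a², f₂ = ab, f₃ = ac, f₄ = ad, f₅ = b², f₆ = ae + bd, f₇ = d², for every k with 2 ≤ k ≤ 7 the colon ideal (f₁,…,f_{k−1}) : (f_k) is generated by homogeneous polynomials of degree 1. -/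
open MvPolynomial

noncomputable def killV (K : Type*) [Field K] (s : Finset (Fin 5)) :
    MvPolynomial (Fin 5) K →ₐ[K] MvPolynomial (Fin 5) K :=
  aeval (fun i => if i ∈ s then 0 else X i)

lemma killV_X (K : Type*) [Field K] (s : Finset (Fin 5)) (i : Fin 5) :
    killV K s (X i) = if i ∈ s then 0 else X i := by
  simp [killV]

lemma killV_mem (K : Type*) [Field K] (s : Finset (Fin 5)) (g : MvPolynomial (Fin 5) K)
    (h : killV K s g = 0) : g ∈ Ideal.span (X '' (s : Set (Fin 5)) : Set (MvPolynomial (Fin 5) K)) := by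
  set I := Ideal.span (X '' (s : Set (Fin 5)) : Set (MvPolynomial (Fin 5) K)) with hI
  have key : (Ideal.Quotient.mkₐ K I).comp (killV K s) = Ideal.Quotient.mkₐ K I := by
    apply MvPolynomial.algHom_ext
    intro i
    rw [AlgHom.comp_apply, killV_X]
    split_ifs with hi
    · rw [map_zero]
      symm
      exact Ideal.Quotient.eq_zero_iff_mem.2 (Ideal.subset_span ⟨i, hi, rfl⟩)
    · rfl
  have h2 := DFunLike.congr_fun key g
  rw [AlgHom.comp_apply, h, map_zero] at h2
  exact Ideal.Quotient.eq_zero_iff_mem.1 h2.symm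

lemma colon_aux (K : Type*) [Field K] (f : Fin 7 → MvPolynomial (Fin 5) K) (k : Fin 7)
    (s : Finset (Fin 5))
    (h1 : ∀ i ∈ s, ∃ c : Fin 7 → MvPolynomial (Fin 5) K,
      X i * f k = ∑ j, if j < k then c j * f j else 0)
    (h2 : ∀ (g : MvPolynomial (Fin 5) K) (c : Fin 7 → MvPolynomial (Fin 5) K),
      g * f k = (∑ j, if j < k then c j * f j else 0) → killV K s g = 0) :
    ∃ S : Set (MvPolynomial (Fin 5) K), (∀ g ∈ S, MvPolynomial.IsHomogeneous g 1) ∧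
        Submodule.colon (Ideal.span {g | ∃ j : Fin 7, j < k ∧ g = f j})
            (Ideal.span {f k}) = Ideal.span S := by
  have hm : ∀ x, x ∈ Ideal.span {g | ∃ j : Fin 7, j < k ∧ g = f j} ↔
      ∃ c : Fin 7 → MvPolynomial (Fin 5) K, x = ∑ j, if j < k then c j * f j else 0 := by
    intro x
    constructor
    · intro hx
      induction hx using Submodule.span_induction with
      | mem x h =>
        obtain ⟨j, hj, rfl⟩ := h
        refine ⟨Pi.single j 1, ?_⟩
        rw [Finset.sum_eq_single j]
        · simp [hj]
        · intro b _ hb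
          simp [Pi.single_apply, hb]
        · simp
      | zero => exact ⟨0, by simp⟩
      | add x y _ _ hx hy =>
        obtain ⟨c, rfl⟩ := hx
        obtain ⟨d, rfl⟩ := hy
        refine ⟨c + d, ?_⟩
        rw [← Finset.sum_add_distrib]
        refine Finset.sum_congr rfl fun j _ => ?_
        split_ifs <;> simp [add_mul]
      | smul a x _ hx =>
        obtain ⟨c, rfl⟩ := hx
        refine ⟨fun j => a * c j, ?_⟩
        rw [smul_eq_mul, Finset.mul_sum]
        refine Finset.sum_congr rfl fun j _ => ?_
        split_ifs <;> simp [mul_assoc]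
    · rintro ⟨c, rfl⟩
      refine Ideal.sum_mem _ fun j _ => ?_
      split_ifs with h
      · exact Ideal.mul_mem_left _ _ (Ideal.subset_span ⟨j, h, rfl⟩)
      · exact Ideal.zero_mem _
  refine ⟨X '' (s : Set (Fin 5)), ?_, ?_⟩
  · rintro _ ⟨i, _, rfl⟩
    exact isHomogeneous_X _ _
  · apply le_antisymm
    · intro g hg
      rw [Submodule.mem_colon] at hg
      have := hg (f k) (Ideal.subset_span rfl)
      rw [smul_eq_mul, hm] at this
      obtain ⟨c, hc⟩ := this
      exact killV_mem K s g (h2 g c hc)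
    · rw [Ideal.span_le]
      rintro _ ⟨i, hi, rfl⟩
      rw [SetLike.mem_coe, Submodule.mem_colon]
      intro p hp
      obtain ⟨q, rfl⟩ := Ideal.mem_span_singleton'.1 hp
      rw [smul_eq_mul, mul_left_comm]
      exact Ideal.mul_mem_left _ _ ((hm _).2 (h1 i hi))

/-- Over any field `K`, the ideal
`I = (a², ab, ac, ad, b², ae + bd, d²)` of `K[a,b,c,d,e]` has linear quotients with
respect to its generators in the given order: with `f₁ = a², f₂ = ab, f₃ = ac,
f₄ = ad, f₅ = b², f₆ = ae + bd, f₇ = d²`, for every `k` with `2 ≤ k ≤ 7` the colon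
ideal `(f₁,…,f_{k-1}) : (f_k)` is generated by homogeneous polynomials of degree `1`.
Here `a,b,c,d,e` are `X 0, X 1, X 2, X 3, X 4` in `MvPolynomial (Fin 5) K`. -/
theorem stmt12 (K : Type*) [Field K]
    (f : Fin 7 → MvPolynomial (Fin 5) K)
    (hf : f = ![X 0 ^ 2, X 0 * X 1, X 0 * X 2, X 0 * X 3, X 1 ^ 2,
      X 0 * X 4 + X 1 * X 3, X 3 ^ 2]) :
    ∀ k : Fin 7, 1 ≤ (k : ℕ) →
      ∃ S : Set (MvPolynomial (Fin 5) K), (∀ g ∈ S, MvPolynomial.IsHomogeneous g 1) ∧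
        Submodule.colon (Ideal.span {g | ∃ j : Fin 7, j < k ∧ g = f j})
            (Ideal.span {f k}) = Ideal.span S := by
  have e0 : f 0 = X 0 ^ 2 := by rw [hf]; rfl
  have e1 : f 1 = X 0 * X 1 := by rw [hf]; rfl
  have e2 : f 2 = X 0 * X 2 := by rw [hf]; rfl
  have e3 : f 3 = X 0 * X 3 := by rw [hf]; rfl
  have e4 : f 4 = X 1 ^ 2 := by rw [hf]; rfl
  have e5 : f 5 = X 0 * X 4 + X 1 * X 3 := by rw [hf]; rfl
  have e6 : f 6 = X 3 ^ 2 := by rw [hf]; rfl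
  clear hf
  have hX : ∀ i : Fin 5, (X i : MvPolynomial (Fin 5) K) ≠ 0 := fun i => X_ne_zero i
  have k0 : ∀ (s : Finset (Fin 5)) i, i ∈ s → killV K s (X i) = 0 := fun s i h => by
    rw [killV_X, if_pos h]
  have k1 : ∀ (s : Finset (Fin 5)) i, i ∉ s → killV K s (X i) = X i := fun s i h => by
    rw [killV_X, if_neg h]
  intro k hk
  fin_cases k
  · simp at hk
  · refine colon_aux K f 1 {0} ?_ ?_
    · intro i hi
      fin_cases hi
      exact ⟨![X 1, 0, 0, 0, 0, 0, 0], by simp [Fin.sum_univ_succ, e0, e1]; ring⟩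
    · intro g c h
      have h' : g * X 1 = c 0 * X 0 := by
        apply mul_left_cancel₀ (hX 0)
        simp [Fin.sum_univ_seven, e0, e1] at h
        linear_combination h
      have := congrArg (killV K {0}) h'
      simpa [killV_X, hX] using this
  · refine colon_aux K f 2 {0, 1} ?_ ?_
    · intro i hi
      fin_cases hi
      · exact ⟨![X 2, 0, 0, 0, 0, 0, 0], by simp [Fin.sum_univ_seven, e0, e1, e2]; ring⟩
      · exact ⟨![0, X 2, 0, 0, 0, 0, 0], by simp [Fin.sum_univ_seven, e0, e1, e2]; ring⟩
    · intro g c h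
      have h' : g * X 2 = c 0 * X 0 + c 1 * X 1 := by
        apply mul_left_cancel₀ (hX 0)
        simp [Fin.sum_univ_seven, e0, e1, e2] at h
        linear_combination h
      have := congrArg (killV K {0, 1}) h'
      simpa [killV_X, hX] using this
  · refine colon_aux K f 3 {0, 1, 2} ?_ ?_
    · intro i hi
      fin_cases hi
      · exact ⟨![X 3, 0, 0, 0, 0, 0, 0], by simp [Fin.sum_univ_seven, e0, e1, e2, e3]; ring⟩
      · exact ⟨![0, X 3, 0, 0, 0, 0, 0], by simp [Fin.sum_univ_seven, e0, e1, e2, e3]; ring⟩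
      · exact ⟨![0, 0, X 3, 0, 0, 0, 0], by simp [Fin.sum_univ_seven, e0, e1, e2, e3]; ring⟩
    · intro g c h
      have h' : g * X 3 = c 0 * X 0 + c 1 * X 1 + c 2 * X 2 := by
        apply mul_left_cancel₀ (hX 0)
        simp [Fin.sum_univ_seven, e0, e1, e2, e3] at h
        linear_combination h
      have := congrArg (killV K {0, 1, 2}) h'
      simpa [killV_X, hX] using this
  · refine colon_aux K f 4 {0} ?_ ?_
    · intro i hi
      fin_cases hi
      exact ⟨![0, X 1, 0, 0, 0, 0, 0], by simp [Fin.sum_univ_seven, e0, e1, e2, e3, e4]; ring⟩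
    · intro g c h
      simp [Fin.sum_univ_seven, e0, e1, e2, e3, e4] at h
      have := congrArg (killV K {0}) h
      simpa [killV_X, hX] using this
  · refine colon_aux K f 5 {0, 1} ?_ ?_
    · intro i hi
      fin_cases hi
      · exact ⟨![X 4, X 3, 0, 0, 0, 0, 0],
          by simp [Fin.sum_univ_seven, e0, e1, e2, e3, e4, e5]; ring⟩
      · exact ⟨![0, X 4, 0, 0, X 3, 0, 0],
          by simp [Fin.sum_univ_seven, e0, e1, e2, e3, e4, e5]; ring⟩
    · intro g c h
      simp [Fin.sum_univ_seven, e0, e1, e2, e3, e4, e5] at h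
      have h3 := congrArg (killV K {0}) h
      simp [killV_X] at h3
      have h4 : killV K {0} g * X 3 = killV K {0} (c 4) * X 1 := by
        apply mul_left_cancel₀ (hX 1)
        linear_combination h3
      have h5 := congrArg (killV K {0, 1}) h4
      have hc : ∀ x, killV K {0, 1} (killV K {0} x) = killV K {0, 1} x := by
        intro x
        have : (killV K {0, 1}).comp (killV K {0}) = killV K {0, 1} := by
          apply MvPolynomial.algHom_ext
          intro i
          fin_cases i <;> simp [killV_X]
        exact DFunLike.congr_fun this x
      simpa [killV_X, hX, hc] using h5
  · refine colon_aux K f 6 {0, 1} ?_ ?_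
    · intro i hi
      fin_cases hi
      · exact ⟨![0, 0, 0, X 3, 0, 0, 0],
          by simp [Fin.sum_univ_seven, e0, e1, e2, e3, e4, e5, e6]; ring⟩
      · exact ⟨![0, 0, 0, -X 4, 0, X 3, 0],
          by simp [Fin.sum_univ_seven, e0, e1, e2, e3, e4, e5, e6]; ring⟩
    · intro g c h
      simp [Fin.sum_univ_seven, e0, e1, e2, e3, e4, e5, e6] at h
      have := congrArg (killV K {0, 1}) h
      simpa [killV_X, hX] using this
end
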